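/- arXiv:2311.03011 — 3 statements merged into one kernel-verified Lean document; each statement's English description precedes it below -/
import Mathlib

section
/- For every integer n ≥ 9, one has a(n) ≥ α(n), where α(n) = (8/27)n⁴ − (464/729)n³ + c(n) and c(n) depends on the residue of n modulo 9 as follows: if n ≡ 0 (mod 9), c(n) = −(4/3)n² + 6n − 2; if n ≡ 1, c(n) = −(292/243)n² + (922/243)n − 1642/729; if n ≡ 2, c(n) = −(308/243)n² + (946/243)n − 1724/729; if n ≡ 3, c(n) = −(4/3)n² + (158/27)n − 64/27; if n ≡ 4, c(n) = −(292/243)n² + (886/243)n − 1804/729; if n ≡ 5, c(n) = −(308/243)n² + (874/243)n − 1400/729; if n ≡ 6, c(n) = −(4/3)n² + (158/27)n − 44/27; if n ≡ 7, c(n) = −(292/243)n² + (886/243)n − 1264/729; if n ≡ 8, c(n) = −(308/243)n² + (946/243)n − 1292/729. (For n ≥ 9 and n ≡ i mod 9, α(n) is an integer.) -/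
/-- The grid `A_n = {(x,y) ∈ ℤ² : 1 ≤ x, y ≤ n}`. -/
def gridSet (n : ℕ) : Set (ℤ × ℤ) :=
  {p | 1 ≤ p.1 ∧ p.1 ≤ (n : ℤ) ∧ 1 ≤ p.2 ∧ p.2 ≤ (n : ℤ)}

/-- The embedding of an integer lattice point into the real plane. -/
def toR2 (p : ℤ × ℤ) : ℝ × ℝ := ((p.1 : ℝ), (p.2 : ℝ))

/-- Squared Euclidean distance between two lattice points, as a natural number. -/
def sqLen (p q : ℤ × ℤ) : ℕ := (q.1 - p.1).natAbs ^ 2 + (q.2 - p.2).natAbs ^ 2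

/-- `f : ZMod (n²) → ℤ × ℤ` is a simple closed grid polygon on `A_n`:
it is a bijection onto `A_n`, and any two distinct (closed) edges of the closed
polygonal curve `f 0, f 1, …, f (n²-1), f 0` meet only in common endpoints. -/
structure IsSimpleClosedGridPolygon (n : ℕ) (f : ZMod (n ^ 2) → ℤ × ℤ) : Prop where
  inj : Function.Injective f
  range_eq : Set.range f = gridSet n
  simple : ∀ i j : ZMod (n ^ 2), i ≠ j →
    segment ℝ (toR2 (f i)) (toR2 (f (i + 1))) ∩
        segment ℝ (toR2 (f j)) (toR2 (f (j + 1))) ⊆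
      ({toR2 (f i), toR2 (f (i + 1))} : Set (ℝ × ℝ)) ∩
        ({toR2 (f j), toR2 (f (j + 1))} : Set (ℝ × ℝ))

/-- The weight `s(f)`: sum of the squared Euclidean side lengths. -/
def polyWeight (n : ℕ) (f : ZMod (n ^ 2) → ℤ × ℤ) : ℕ :=
  ∑ i ∈ Finset.range (n ^ 2), sqLen (f (i : ZMod (n ^ 2))) (f ((i : ZMod (n ^ 2)) + 1))

/-- `a(n)`: the maximal weight of a simple closed grid polygon on `A_n`. -/
noncomputable def polyA (n : ℕ) : ℕ :=
  sSup {w : ℕ | ∃ f, IsSimpleClosedGridPolygon n f ∧ polyWeight n f = w}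

/-- A grid polygon is proper if no three consecutive vertices are collinear. -/
def IsProper (n : ℕ) (f : ZMod (n ^ 2) → ℤ × ℤ) : Prop :=
  ∀ i : ZMod (n ^ 2),
    ¬ Collinear ℝ ({toR2 (f i), toR2 (f (i + 1)), toR2 (f (i + 2))} : Set (ℝ × ℝ))

/-- `a₀(n)`: the maximal weight of a proper simple closed grid polygon on `A_n`
(the supremum in `ℕ`, equal to `0` if no proper polygon exists). -/
noncomputable def polyA0 (n : ℕ) : ℕ :=
  sSup {w : ℕ | ∃ f, IsSimpleClosedGridPolygon n f ∧ IsProper n f ∧ polyWeight n f = w}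


/-- The residue-dependent correction term `c(n)` of the main theorem. -/
def cCorr (n : ℕ) : ℚ :=
  if n % 9 = 0 then -(4/3) * n ^ 2 + 6 * n - 2
  else if n % 9 = 1 then -(292/243) * n ^ 2 + (922/243) * n - 1642/729
  else if n % 9 = 2 then -(308/243) * n ^ 2 + (946/243) * n - 1724/729
  else if n % 9 = 3 then -(4/3) * n ^ 2 + (158/27) * n - 64/27
  else if n % 9 = 4 then -(292/243) * n ^ 2 + (886/243) * n - 1804/729
  else if n % 9 = 5 then -(308/243) * n ^ 2 + (874/243) * n - 1400/729
  else if n % 9 = 6 then -(4/3) * n ^ 2 + (158/27) * n - 44/27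
  else if n % 9 = 7 then -(292/243) * n ^ 2 + (886/243) * n - 1264/729
  else -(308/243) * n ^ 2 + (946/243) * n - 1292/729

/-- The sequence `α(n)` from the main theorem. -/
def alphaSeq (n : ℕ) : ℚ := (8/27) * n ^ 4 - (464/729) * n ^ 3 + cCorr n

/-- The residue-dependent correction term `d(n)`. -/
def dCorr (n : ℕ) : ℚ :=
  if n % 3 = 0 then 0
  else if n % 3 = 1 then -(8 * n + 4) / 27
  else -(16 * n - 16) / 27

/-- The first-approximation sequence `β(n)`. -/
def betaSeq (n : ℕ) : ℚ :=
  (8/27) * n ^ 4 - (32/27) * n ^ 3 + (16/3) * n ^ 2 - 18 * n + 20 + dCorr n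

/-- The gain function `F(j,k)`. -/
def Fgain (j k : ℤ) : ℤ :=
  4 * j ^ 3 - (8 * k + 2) * j ^ 2 + (4 * k ^ 2 + 4 * k) * j - 2 * k ^ 2 - 2 * k + 3

/-- The maximal gain `U(k)`, defined piecewise by `k` modulo 3:
`U(3s) = 16s³ − 8s² − 6s + 3`, `U(3s+1) = 16s³ + 8s² − 6s + 1`,
`U(3s+2) = 16s³ + 24s² + 6s + 1`. -/
def Ugain (k : ℤ) : ℤ :=
  if k % 3 = 0 then 16 * (k / 3) ^ 3 - 8 * (k / 3) ^ 2 - 6 * (k / 3) + 3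
  else if k % 3 = 1 then 16 * (k / 3) ^ 3 + 8 * (k / 3) ^ 2 - 6 * (k / 3) + 1
  else 16 * (k / 3) ^ 3 + 24 * (k / 3) ^ 2 + 6 * (k / 3) + 1

/-- The weight `s(n;p,q)` of the fjord construction with `p` fjords at the bottom
and `q` fjords to the right. -/
def sFjord (n : ℕ) (p q : ℤ) : ℚ :=
  betaSeq n - 4 * n ^ 2 + 20 * n - 18
    + (p : ℚ) * ((n : ℚ) - p - 2) ^ 2 + (p : ℚ) * ((n : ℚ) - p - 1) ^ 2
      - (Ugain (p + 2) : ℚ) - (p : ℚ)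
    + (q : ℚ) * ((n : ℚ) - q - 2) ^ 2 + (q : ℚ) * ((n : ℚ) - q - 1) ^ 2
      - (Ugain (q + 1) : ℚ) - (q : ℚ)

/-- A directed edge between two lattice points. -/
abbrev LatticeEdge := (ℤ × ℤ) × (ℤ × ℤ)

/-- `IsEdgePath a b E` says that the consecutive edges in `E` lead from `a` to `b`. -/
def IsEdgePath : ℤ × ℤ → ℤ × ℤ → List LatticeEdge → Prop
  | a, b, [] => a = b
  | a, b, e :: E => e.1 = a ∧ IsEdgePath e.2 b E

/-- The difference vector of an edge is primitive. -/
def IsPrimitiveEdge (e : LatticeEdge) : Prop :=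
  IsCoprime (e.2.1 - e.1.1) (e.2.2 - e.1.2)

/-- An affine line weakly separates `e` from `e'`, and does not contain both of them. -/
def WeaklySeparated (e e' : LatticeEdge) : Prop :=
  ∃ a b c : ℤ, a * e.1.1 + b * e.1.2 ≤ c ∧ a * e.2.1 + b * e.2.2 ≤ c ∧
    c ≤ a * e'.1.1 + b * e'.1.2 ∧ c ≤ a * e'.2.1 + b * e'.2.2 ∧
    (a * e.1.1 + b * e.1.2) + (a * e.2.1 + b * e.2.2) <
      (a * e'.1.1 + b * e'.1.2) + (a * e'.2.1 + b * e'.2.2)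

/-- The squared length of an edge. -/
def edgeWeight (e : LatticeEdge) : ℤ := (e.2.1 - e.1.1) ^ 2 + (e.2.2 - e.1.2) ^ 2

/-- The sum of the squared lengths of a list of edges. -/
def totalWeight (E : List LatticeEdge) : ℤ := (E.map edgeWeight).sum

theorem cast_sqLen (e : LatticeEdge) : (sqLen e.1 e.2 : ℤ) = edgeWeight e := by
  simp [sqLen, edgeWeight]

theorem IsEdgePath.append {a b c : ℤ × ℤ} {E F : List LatticeEdge}
    (hE : IsEdgePath a b E) (hF : IsEdgePath b c F) : IsEdgePath a c (E ++ F) := by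
  induction E generalizing a with
  | nil => cases hE; exact hF
  | cons e E ih => exact ⟨hE.1, ih hE.2⟩

theorem IsEdgePath.getElem_zero {a b : ℤ × ℤ} {E : List LatticeEdge}
    (hE : IsEdgePath a b E) (h : 0 < E.length) : E[0].1 = a := by
  cases E with
  | nil => simp at h
  | cons e E => exact hE.1

theorem IsEdgePath.getElem_succ {a b : ℤ × ℤ} {E : List LatticeEdge}
    (hE : IsEdgePath a b E) (i : ℕ) (h : i + 1 < E.length) : E[i].2 = E[i + 1].1 := by
  induction E generalizing a i with
  | nil => simp at h
  | cons e E ih =>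
    cases i with
    | zero =>
      have h' : 0 < E.length := by simpa using h
      exact (hE.2.getElem_zero h').symm
    | succ i => exact ih hE.2 i (by simpa using h)

theorem IsEdgePath.getElem_last {a b : ℤ × ℤ} {E : List LatticeEdge}
    (hE : IsEdgePath a b E) (i : ℕ) (h : i + 1 = E.length) : E[i].2 = b := by
  induction E generalizing a i with
  | nil => simp at h
  | cons e E ih =>
    cases i with
    | zero =>
      have h' : E = [] := by simpa [eq_comm] using h
      subst h'
      exact hE.2
    | succ i => exact ih hE.2 i (by simpa using h)

theorem exists_of_mem_segment_toR2 {p q : ℤ × ℤ} {x : ℝ × ℝ}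
    (hx : x ∈ segment ℝ (toR2 p) (toR2 q)) :
    ∃ t : ℝ, 0 ≤ t ∧ t ≤ 1 ∧ x.1 = p.1 + t * (q.1 - p.1) ∧ x.2 = p.2 + t * (q.2 - p.2) := by
  rw [segment_eq_image] at hx
  obtain ⟨t, ⟨h0, h1⟩, rfl⟩ := hx
  refine ⟨t, h0, h1, ?_, ?_⟩ <;> simp [toR2] <;> ring

/-- A primitive segment contains no lattice points besides its endpoints. -/
theorem eq_endpoint_of_mem_segment {e : LatticeEdge} (he : IsPrimitiveEdge e) {z : ℤ × ℤ}
    (hz : toR2 z ∈ segment ℝ (toR2 e.1) (toR2 e.2)) : z = e.1 ∨ z = e.2 := by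
  obtain ⟨t, h0, h1, hx, hy⟩ := exists_of_mem_segment_toR2 hz
  obtain ⟨u, v, huv⟩ := he
  simp only [toR2] at hx hy
  have huv' : (u : ℝ) * (e.2.1 - e.1.1) + v * (e.2.2 - e.1.2) = 1 := by exact_mod_cast huv
  have ht : ((u * (z.1 - e.1.1) + v * (z.2 - e.1.2) : ℤ) : ℝ) = t := by
    push_cast
    linear_combination u * hx + v * hy + t * huv'
  have hk0 : 0 ≤ u * (z.1 - e.1.1) + v * (z.2 - e.1.2) := by
    have := h0; rw [← ht] at this; exact_mod_cast this
  have hk1 : u * (z.1 - e.1.1) + v * (z.2 - e.1.2) ≤ 1 := by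
    have := h1; rw [← ht] at this; exact_mod_cast this
  rcases (by omega : u * (z.1 - e.1.1) + v * (z.2 - e.1.2) = 0 ∨
    u * (z.1 - e.1.1) + v * (z.2 - e.1.2) = 1) with hk | hk
  · left
    rw [hk] at ht
    have ht' : t = 0 := by rw [← ht]; simp
    subst ht'
    ext
    · have : (z.1 : ℝ) = e.1.1 := by linarith
      exact_mod_cast this
    · have : (z.2 : ℝ) = e.1.2 := by linarith
      exact_mod_cast this
  · right
    rw [hk] at ht
    have ht' : t = 1 := by rw [← ht]; simp
    subst ht'
    ext
    · have : (z.1 : ℝ) = e.2.1 := by linarith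
      exact_mod_cast this
    · have : (z.2 : ℝ) = e.2.2 := by linarith
      exact_mod_cast this

theorem eq_endpoint_or_of_mem_segment {p q : ℤ × ℤ} {x : ℝ × ℝ} {a b c : ℝ}
    (hx : x ∈ segment ℝ (toR2 p) (toR2 q)) (hp : a * p.1 + b * p.2 ≤ c)
    (hq : a * q.1 + b * q.2 ≤ c) (hc : c ≤ a * x.1 + b * x.2) :
    x = toR2 p ∨ x = toR2 q ∨ (a * p.1 + b * p.2 = c ∧ a * q.1 + b * q.2 = c) := by
  obtain ⟨t, h0, h1, hx1, hx2⟩ := exists_of_mem_segment_toR2 hx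
  rcases h0.eq_or_lt with rfl | h0
  · left; ext <;> simp [toR2, hx1, hx2]
  rcases h1.eq_or_lt with rfl | h1
  · right; left; ext <;> simp [toR2, hx1, hx2]
  right; right
  have key : c ≤ (1 - t) * (a * p.1 + b * p.2) + t * (a * q.1 + b * q.2) := by
    rw [hx1, hx2] at hc; linarith
  constructor <;> apply le_antisymm <;> first | assumption | nlinarith

theorem le_of_mem_segment {p q : ℤ × ℤ} {x : ℝ × ℝ} {a b c : ℝ}
    (hx : x ∈ segment ℝ (toR2 p) (toR2 q)) (hp : a * p.1 + b * p.2 ≤ c)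
    (hq : a * q.1 + b * q.2 ≤ c) : a * x.1 + b * x.2 ≤ c := by
  obtain ⟨t, h0, h1, hx1, hx2⟩ := exists_of_mem_segment_toR2 hx
  rw [hx1, hx2]
  nlinarith

theorem WeaklySeparated.segment_inter_subset {e e' : LatticeEdge} (h : WeaklySeparated e e')
    (he : IsPrimitiveEdge e) (he' : IsPrimitiveEdge e') :
    segment ℝ (toR2 e.1) (toR2 e.2) ∩ segment ℝ (toR2 e'.1) (toR2 e'.2) ⊆
      ({toR2 e.1, toR2 e.2} : Set (ℝ × ℝ)) ∩ ({toR2 e'.1, toR2 e'.2} : Set (ℝ × ℝ)) := by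
  rintro x ⟨hx, hx'⟩
  obtain ⟨a, b, c, h1, h2, h3, h4, h5⟩ := h
  have g1 : (a : ℝ) * e.1.1 + b * e.1.2 ≤ c := by exact_mod_cast h1
  have g2 : (a : ℝ) * e.2.1 + b * e.2.2 ≤ c := by exact_mod_cast h2
  have g3 : (-a : ℝ) * e'.1.1 + (-b) * e'.1.2 ≤ -c := by
    have : (c : ℝ) ≤ a * e'.1.1 + b * e'.1.2 := by exact_mod_cast h3
    linarith
  have g4 : (-a : ℝ) * e'.2.1 + (-b) * e'.2.2 ≤ -c := by
    have : (c : ℝ) ≤ a * e'.2.1 + b * e'.2.2 := by exact_mod_cast h4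
    linarith
  have g5 : ((a : ℝ) * e.1.1 + b * e.1.2) + (a * e.2.1 + b * e.2.2) <
      (a * e'.1.1 + b * e'.1.2) + (a * e'.2.1 + b * e'.2.2) := by exact_mod_cast h5
  have k1 := le_of_mem_segment hx g1 g2
  have k2 := le_of_mem_segment hx' g3 g4
  have lattice : ∀ z : ℤ × ℤ, x = toR2 z →
      x ∈ ({toR2 e.1, toR2 e.2} : Set (ℝ × ℝ)) ∩ ({toR2 e'.1, toR2 e'.2} : Set (ℝ × ℝ)) := by
    rintro z rfl
    refine ⟨?_, ?_⟩
    · rcases eq_endpoint_of_mem_segment he hx with rfl | rfl <;> simp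
    · rcases eq_endpoint_of_mem_segment he' hx' with rfl | rfl <;> simp
  rcases eq_endpoint_or_of_mem_segment hx g1 g2 (by linarith) with h | h | ⟨h, h'⟩
  · exact lattice _ h
  · exact lattice _ h
  rcases eq_endpoint_or_of_mem_segment hx' g3 g4 (by linarith) with h'' | h'' | ⟨h'', h'''⟩
  · exact lattice _ h''
  · exact lattice _ h''
  linarith

theorem bddAbove_polyWeight (n : ℕ) :
    BddAbove {w : ℕ | ∃ f, IsSimpleClosedGridPolygon n f ∧ polyWeight n f = w} := by
  refine ⟨n ^ 2 * (n ^ 2 + n ^ 2), ?_⟩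
  rintro w ⟨f, hf, rfl⟩
  have hmem : ∀ i, f i ∈ gridSet n := fun i => hf.range_eq ▸ Set.mem_range_self i
  refine (Finset.sum_le_card_nsmul _ _ (n ^ 2 + n ^ 2) fun i _ => ?_).trans (by simp)
  obtain ⟨a1, a2, a3, a4⟩ := hmem (i : ZMod (n ^ 2))
  obtain ⟨b1, b2, b3, b4⟩ := hmem ((i : ZMod (n ^ 2)) + 1)
  unfold sqLen
  gcongr <;> omega

theorem sum_map_eq_sum_range_getElem {α : Type*} (g : α → ℕ) (l : List α) (N : ℕ)
    (hN : l.length = N) (F : ℕ → ℕ) (hF : ∀ i (h : i < l.length), F i = g l[i]) :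
    (l.map g).sum = ∑ i ∈ Finset.range N, F i := by
  subst hN
  induction l generalizing F with
  | nil => simp
  | cons a l ih =>
    rw [List.map_cons, List.sum_cons, List.length_cons, Finset.sum_range_succ', add_comm]
    congr 1
    · exact ih (fun i => F (i + 1)) fun i h => hF (i + 1) (by simpa using h)
    · exact (hF 0 (by simp)).symm

theorem length_of_mem_gridSet {n : ℕ} {l : List (ℤ × ℤ)} (hl : l.Nodup)
    (hmem : ∀ z, z ∈ l ↔ z ∈ gridSet n) : l.length = n ^ 2 := by
  have : l.toFinset = Finset.Icc (1 : ℤ) n ×ˢ Finset.Icc (1 : ℤ) n := by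
    ext z
    simp [hmem, gridSet, and_assoc]
  rw [← List.toFinset_card_of_nodup hl, this]
  simp [sq]

/-- A closed path of pairwise separated primitive edges through all grid points yields a lower
bound for `polyA`. -/
theorem totalWeight_le_polyA {n : ℕ} (hn : 2 ≤ n) {a : ℤ × ℤ} {E : List LatticeEdge}
    (hE : IsEdgePath a a E) (hnd : (E.map Prod.fst).Nodup)
    (hmem : ∀ z, z ∈ E.map Prod.fst ↔ z ∈ gridSet n)
    (hprim : ∀ e ∈ E, IsPrimitiveEdge e) (hsep : E.Pairwise WeaklySeparated) :
    totalWeight E ≤ polyA n := by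
  have hlen : E.length = n ^ 2 := by
    simpa using length_of_mem_gridSet hnd hmem
  have hpos : 1 < n ^ 2 := by nlinarith
  have : NeZero (n ^ 2) := ⟨by omega⟩
  have : Fact (1 < n ^ 2) := ⟨hpos⟩
  have hlt : ∀ i : ZMod (n ^ 2), i.val < E.length := fun i => hlen.symm ▸ ZMod.val_lt i
  let f : ZMod (n ^ 2) → ℤ × ℤ := fun i => (E[i.val]'(hlt i)).1
  have hsucc : ∀ i, f (i + 1) = (E[i.val]'(hlt i)).2 := by
    intro i
    have hi := ZMod.val_lt i
    have hv : (i + 1).val = (i.val + 1) % n ^ 2 := by rw [ZMod.val_add, ZMod.val_one]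
    by_cases h : i.val + 1 = n ^ 2
    · rw [hE.getElem_last i.val (by omega)]
      have : (i + 1).val = 0 := by rw [hv, h, Nat.mod_self]
      simp only [f, this]
      exact hE.getElem_zero _
    · rw [Nat.mod_eq_of_lt (by omega)] at hv
      simp only [f, hv]
      exact (hE.getElem_succ i.val (by omega)).symm
  have hf : IsSimpleClosedGridPolygon n f := by
    refine ⟨?_, ?_, ?_⟩
    · intro i j hij
      apply ZMod.val_injective
      have := (List.nodup_iff_injective_get.mp hnd)
        (a₁ := ⟨i.val, by simpa using hlt i⟩) (a₂ := ⟨j.val, by simpa using hlt j⟩)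
        (by simpa using hij)
      simpa using this
    · ext z
      rw [← hmem, List.mem_iff_getElem]
      constructor
      · rintro ⟨i, rfl⟩
        exact ⟨i.val, by simpa using hlt i, by simp [f]⟩
      · rintro ⟨i, hi, rfl⟩
        have hi' : i < n ^ 2 := by simpa [hlen] using hi
        refine ⟨(i : ZMod (n ^ 2)), ?_⟩
        simp [f, ZMod.val_cast_of_lt hi']
    · intro i j hij
      rw [hsucc, hsucc]
      have hi := List.getElem_mem (hlt i)
      have hj := List.getElem_mem (hlt j)
      have hval : i.val ≠ j.val := fun h => hij (ZMod.val_injective _ h)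
      rcases lt_or_gt_of_ne hval with h | h
      · exact (List.pairwise_iff_getElem.mp hsep _ _ (hlt i) (hlt j) h).segment_inter_subset
          (hprim _ hi) (hprim _ hj)
      · rw [Set.inter_comm, Set.inter_comm {_, _}]
        exact (List.pairwise_iff_getElem.mp hsep _ _ (hlt j) (hlt i) h).segment_inter_subset
          (hprim _ hj) (hprim _ hi)
  have hw : totalWeight E = polyWeight n f := by
    have h1 : (E.map fun e => sqLen e.1 e.2).sum = polyWeight n f := by
      refine sum_map_eq_sum_range_getElem _ _ _ hlen _ fun i hi => ?_
      rw [hsucc]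
      simp [f, ZMod.val_cast_of_lt (hlen ▸ hi)]
    rw [← h1, totalWeight, Nat.cast_list_sum, List.map_map]
    congr 1
    exact List.map_congr_left fun e _ => (cast_sqLen e).symm
  rw [hw]
  exact_mod_cast le_csSup (bddAbove_polyWeight n) ⟨f, hf, rfl⟩

/-- The zigzag `A, B, A + w, B + w, A + 2w, …` with `m` edges. -/
def zigzag : ℤ × ℤ → ℤ × ℤ → ℤ × ℤ → ℕ → List LatticeEdge
  | _, _, _, 0 => []
  | A, B, w, m + 1 => (A, B) :: zigzag B (A + w) w m

/-- The straight walk `A, A + w, A + 2w, …` with `m` edges. -/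
def straightWalk : ℤ × ℤ → ℤ × ℤ → ℕ → List LatticeEdge
  | _, _, 0 => []
  | A, w, m + 1 => (A, A + w) :: straightWalk (A + w) w m

theorem mem_zigzag {A B w : ℤ × ℤ} {m : ℕ} {e : LatticeEdge} :
    e ∈ zigzag A B w m ↔ ∃ i : ℤ, 0 ≤ i ∧
      ((2 * i < m ∧ e = (A + i • w, B + i • w)) ∨
        (2 * i + 1 < m ∧ e = (B + i • w, A + (i + 1) • w))) := by
  induction m generalizing A B with
  | zero =>
    simp only [zigzag, List.not_mem_nil, false_iff]
    rintro ⟨i, hi, ⟨h, -⟩ | ⟨h, -⟩⟩ <;> push_cast at h <;> omega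
  | succ m ih =>
    rw [zigzag, List.mem_cons, ih]
    constructor
    · rintro (rfl | ⟨i, hi, ⟨h, rfl⟩ | ⟨h, rfl⟩⟩)
      · exact ⟨0, le_rfl, Or.inl ⟨by push_cast; omega, by simp⟩⟩
      · refine ⟨i, hi, Or.inr ⟨by push_cast; omega, ?_⟩⟩
        rw [add_smul, one_smul]
        congr 1
        abel
      · refine ⟨i + 1, by omega, Or.inl ⟨by push_cast; omega, ?_⟩⟩
        rw [add_smul, one_smul]
        congr 1
        abel
    · rintro ⟨i, hi, ⟨h, rfl⟩ | ⟨h, rfl⟩⟩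
      · rcases hi.eq_or_lt with rfl | hi
        · left; simp
        · right
          refine ⟨i - 1, by omega, Or.inr ⟨by push_cast at h; omega, ?_⟩⟩
          rw [sub_smul, one_smul, sub_add_cancel]
          congr 1
          abel
      · right
        refine ⟨i, hi, Or.inl ⟨by push_cast at h; omega, ?_⟩⟩
        rw [add_smul, one_smul]
        congr 1
        abel

theorem mem_straightWalk {A w : ℤ × ℤ} {m : ℕ} {e : LatticeEdge} :
    e ∈ straightWalk A w m ↔ ∃ i : ℤ, 0 ≤ i ∧ i < m ∧ e = (A + i • w, A + (i + 1) • w) := by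
  induction m generalizing A with
  | zero =>
    simp only [straightWalk, List.not_mem_nil, false_iff]
    rintro ⟨i, hi, h, -⟩
    push_cast at h
    omega
  | succ m ih =>
    rw [straightWalk, List.mem_cons, ih]
    constructor
    · rintro (rfl | ⟨i, hi, h, rfl⟩)
      · exact ⟨0, le_rfl, by push_cast; omega, by simp⟩
      · refine ⟨i + 1, by omega, by push_cast; omega, ?_⟩
        simp only [add_smul, one_smul]
        congr 1 <;> abel
    · rintro ⟨i, hi, h, rfl⟩
      rcases hi.eq_or_lt with rfl | hi
      · left; simp
      · right
        refine ⟨i - 1, by omega, by push_cast at h; omega, ?_⟩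
        simp only [add_smul, sub_smul, one_smul]
        congr 1 <;> abel

theorem mem_map_fst_zigzag {A B w : ℤ × ℤ} {m : ℕ} {z : ℤ × ℤ} :
    z ∈ (zigzag A B w m).map Prod.fst ↔ ∃ i : ℤ, 0 ≤ i ∧
      ((2 * i < m ∧ z = A + i • w) ∨ (2 * i + 1 < m ∧ z = B + i • w)) := by
  rw [List.mem_map]
  constructor
  · rintro ⟨e, he, rfl⟩
    obtain ⟨i, hi, ⟨h, rfl⟩ | ⟨h, rfl⟩⟩ := mem_zigzag.mp he
    exacts [⟨i, hi, Or.inl ⟨h, rfl⟩⟩, ⟨i, hi, Or.inr ⟨h, rfl⟩⟩]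
  · rintro ⟨i, hi, ⟨h, rfl⟩ | ⟨h, rfl⟩⟩
    exacts [⟨_, mem_zigzag.mpr ⟨i, hi, Or.inl ⟨h, rfl⟩⟩, rfl⟩,
      ⟨_, mem_zigzag.mpr ⟨i, hi, Or.inr ⟨h, rfl⟩⟩, rfl⟩]

theorem mem_map_fst_straightWalk {A w : ℤ × ℤ} {m : ℕ} {z : ℤ × ℤ} :
    z ∈ (straightWalk A w m).map Prod.fst ↔ ∃ i : ℤ, 0 ≤ i ∧ i < m ∧ z = A + i • w := by
  rw [List.mem_map]
  constructor
  · rintro ⟨e, he, rfl⟩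
    obtain ⟨i, hi, h, rfl⟩ := mem_straightWalk.mp he
    exact ⟨i, hi, h, rfl⟩
  · rintro ⟨i, hi, h, rfl⟩
    exact ⟨_, mem_straightWalk.mpr ⟨i, hi, h, rfl⟩, rfl⟩

theorem isEdgePath_straightWalk (A w : ℤ × ℤ) (m : ℕ) :
    IsEdgePath A (A + (m : ℤ) • w) (straightWalk A w m) := by
  induction m generalizing A with
  | zero => simp [straightWalk, IsEdgePath]
  | succ m ih =>
    refine ⟨rfl, ?_⟩
    convert ih (A + w) using 1
    push_cast
    rw [add_smul, one_smul]
    abel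

theorem isEdgePath_zigzag_even (A B w : ℤ × ℤ) (k : ℕ) :
    IsEdgePath A (A + (k : ℤ) • w) (zigzag A B w (2 * k)) := by
  induction k generalizing A B with
  | zero => simp [zigzag, IsEdgePath]
  | succ k ih =>
    have h : A + w + (k : ℤ) • w = A + ((k + 1 : ℕ) : ℤ) • w := by
      push_cast
      rw [add_smul, one_smul]
      abel
    exact ⟨rfl, rfl, h ▸ ih (A + w) (B + w)⟩

theorem isEdgePath_zigzag_odd (A B w : ℤ × ℤ) (k : ℕ) :
    IsEdgePath A (B + (k : ℤ) • w) (zigzag A B w (2 * k + 1)) := by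
  refine ⟨rfl, isEdgePath_zigzag_even B (A + w) w k⟩

theorem totalWeight_append (E F : List LatticeEdge) :
    totalWeight (E ++ F) = totalWeight E + totalWeight F := by
  simp [totalWeight]

theorem totalWeight_cons (e : LatticeEdge) (E : List LatticeEdge) :
    totalWeight (e :: E) = edgeWeight e + totalWeight E := by
  simp [totalWeight]

theorem totalWeight_nil : totalWeight [] = 0 := rfl

theorem totalWeight_straightWalk (A w : ℤ × ℤ) (m : ℕ) :
    totalWeight (straightWalk A w m) = m * (w.1 ^ 2 + w.2 ^ 2) := by
  induction m generalizing A with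
  | zero => simp [straightWalk, totalWeight_nil]
  | succ m ih =>
    rw [straightWalk, totalWeight_cons, ih]
    simp only [edgeWeight, Prod.fst_add, Prod.snd_add]
    push_cast
    ring

theorem totalWeight_zigzag_even (A B w : ℤ × ℤ) (k : ℕ) :
    totalWeight (zigzag A B w (2 * k)) =
      k * (((B.1 - A.1) ^ 2 + (B.2 - A.2) ^ 2) +
        ((B.1 - A.1 - w.1) ^ 2 + (B.2 - A.2 - w.2) ^ 2)) := by
  induction k generalizing A B with
  | zero => simp [zigzag, totalWeight_nil]
  | succ k ih =>
    rw [Nat.mul_succ, zigzag, zigzag, totalWeight_cons, totalWeight_cons, ih]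
    simp only [edgeWeight, Prod.fst_add, Prod.snd_add]
    push_cast
    ring

theorem totalWeight_zigzag_odd (A B w : ℤ × ℤ) (k : ℕ) :
    totalWeight (zigzag A B w (2 * k + 1)) =
      (k + 1) * ((B.1 - A.1) ^ 2 + (B.2 - A.2) ^ 2) +
        k * ((B.1 - A.1 - w.1) ^ 2 + (B.2 - A.2 - w.2) ^ 2) := by
  rw [zigzag, totalWeight_cons, totalWeight_zigzag_even]
  simp only [edgeWeight, Prod.fst_add, Prod.snd_add]
  ring

theorem isPrimitiveEdge_of_mem_straightWalk {A w : ℤ × ℤ} (hw : IsCoprime w.1 w.2) {m : ℕ}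
    {e : LatticeEdge} (he : e ∈ straightWalk A w m) : IsPrimitiveEdge e := by
  obtain ⟨i, -, -, rfl⟩ := mem_straightWalk.mp he
  obtain ⟨u, v, huv⟩ := hw
  refine ⟨u, v, ?_⟩
  simp only [Prod.fst_add, Prod.snd_add, Prod.smul_fst, Prod.smul_snd, smul_eq_mul]
  linear_combination huv

/-- The cross product of two lattice vectors. -/
def cross (v w : ℤ × ℤ) : ℤ := v.1 * w.2 - v.2 * w.1

theorem isPrimitiveEdge_of_mem_zigzag {A B w : ℤ × ℤ} (hw : IsUnit (cross (B - A) w)) {m : ℕ}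
    {e : LatticeEdge} (he : e ∈ zigzag A B w m) : IsPrimitiveEdge e := by
  have hsq := Int.isUnit_mul_self hw
  generalize hd : cross (B - A) w = d at hsq
  simp only [cross, Prod.fst_sub, Prod.snd_sub] at hd
  obtain ⟨i, -, ⟨-, rfl⟩ | ⟨-, rfl⟩⟩ := mem_zigzag.mp he
  · refine ⟨d * w.2, -d * w.1, ?_⟩
    simp only [Prod.fst_add, Prod.snd_add, Prod.smul_fst, Prod.smul_snd, smul_eq_mul]
    linear_combination hsq + d * hd
  · refine ⟨-d * w.2, d * w.1, ?_⟩
    simp only [Prod.fst_add, Prod.snd_add, Prod.smul_fst, Prod.smul_snd, smul_eq_mul]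
    linear_combination hsq + d * hd

theorem pairwise_straightWalk {w : ℤ × ℤ} (hw : w ≠ 0) (A : ℤ × ℤ) (m : ℕ) :
    (straightWalk A w m).Pairwise WeaklySeparated := by
  have hpos : 0 < w.1 * w.1 + w.2 * w.2 := by
    by_contra! h
    apply hw
    ext
    · simp only [Prod.fst_zero]; nlinarith
    · simp only [Prod.snd_zero]; nlinarith
  induction m generalizing A with
  | zero => exact List.Pairwise.nil
  | succ m ih =>
    refine List.Pairwise.cons (fun e he => ?_) (ih _)
    obtain ⟨i, hi, -, rfl⟩ := mem_straightWalk.mp he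
    refine ⟨w.1, w.2, w.1 * (A.1 + w.1) + w.2 * (A.2 + w.2), ?_, ?_, ?_, ?_, ?_⟩ <;>
      simp only [Prod.fst_add, Prod.snd_add, Prod.smul_fst, Prod.smul_snd, smul_eq_mul] <;>
      nlinarith [mul_nonneg hi hpos.le]

theorem pairwise_zigzag {A B w : ℤ × ℤ} (hw : cross (B - A) w ≠ 0) (m : ℕ) :
    (zigzag A B w m).Pairwise WeaklySeparated := by
  induction m generalizing A B with
  | zero => exact List.Pairwise.nil
  | succ m ih =>
    have hw' : cross (A + w - B) w ≠ 0 := by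
      simp only [cross, Prod.fst_sub, Prod.snd_sub, Prod.fst_add, Prod.snd_add] at hw ⊢
      contrapose! hw
      linear_combination -hw
    refine List.Pairwise.cons (fun e he => ?_) (ih hw')
    set d := cross (B - A) w with hd
    have hpos : 0 < d * d := mul_self_pos.mpr hw
    simp only [cross, Prod.fst_sub, Prod.snd_sub] at hd
    refine ⟨-d * (B.2 - A.2), d * (B.1 - A.1), d * ((B.1 - A.1) * A.2 - (B.2 - A.2) * A.1), ?_⟩
    have key : ∀ i : ℤ, ∀ P : ℤ × ℤ, P = A ∨ P = B →
        -d * (B.2 - A.2) * (P + i • w).1 + d * (B.1 - A.1) * (P + i • w).2 =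
          d * ((B.1 - A.1) * A.2 - (B.2 - A.2) * A.1) + i * (d * d) := by
      rintro i P (rfl | rfl) <;>
        simp only [Prod.fst_add, Prod.snd_add, Prod.smul_fst, Prod.smul_snd, smul_eq_mul] <;>
        rw [hd] <;> ring
    have hA := key 0 A (Or.inl rfl)
    have hB := key 0 B (Or.inr rfl)
    simp only [zero_smul, add_zero, zero_mul] at hA hB
    obtain ⟨i, hi, ⟨-, rfl⟩ | ⟨-, rfl⟩⟩ := mem_zigzag.mp he
    · have h1 := key i B (Or.inr rfl)
      have h2 := key (i + 1) A (Or.inl rfl)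
      have : A + w + i • w = A + (i + 1) • w := by rw [add_smul, one_smul]; abel
      simp only [this]
      rw [hA, hB, h1, h2]
      refine ⟨le_rfl, le_rfl, ?_, ?_, ?_⟩ <;> nlinarith
    · have h1 := key (i + 1) B (Or.inr rfl)
      have h2 := key (i + 1) A (Or.inl rfl)
      have : A + w + i • w = A + (i + 1) • w := by rw [add_smul, one_smul]; abel
      simp only [this]
      rw [hA, hB, h1, h2]
      refine ⟨le_rfl, le_rfl, ?_, ?_, ?_⟩ <;> nlinarith

theorem nodup_map_fst_straightWalk {w : ℤ × ℤ} (hw : w ≠ 0) (A : ℤ × ℤ) (m : ℕ) :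
    ((straightWalk A w m).map Prod.fst).Nodup := by
  induction m generalizing A with
  | zero => exact List.nodup_nil
  | succ m ih =>
    refine List.nodup_cons.mpr ⟨fun h => ?_, ih _⟩
    obtain ⟨i, hi, -, h⟩ := mem_map_fst_straightWalk.mp h
    have h0 : (i + 1) • w = 0 := by
      rw [add_assoc] at h
      rw [add_smul, one_smul, add_comm]
      exact left_eq_add.mp h
    rcases smul_eq_zero.mp h0 with h | h
    · omega
    · exact hw h

theorem nodup_map_fst_zigzag {A B w : ℤ × ℤ} (hw : cross (B - A) w ≠ 0) (m : ℕ) :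
    ((zigzag A B w m).map Prod.fst).Nodup := by
  induction m generalizing A B with
  | zero => exact List.nodup_nil
  | succ m ih =>
    have hw' : cross (A + w - B) w ≠ 0 := by
      simp only [cross, Prod.fst_sub, Prod.snd_sub, Prod.fst_add, Prod.snd_add] at hw ⊢
      contrapose! hw
      linear_combination -hw
    refine List.nodup_cons.mpr ⟨fun h => ?_, ih hw'⟩
    obtain ⟨i, hi, ⟨-, h⟩ | ⟨-, h⟩⟩ := mem_map_fst_zigzag.mp h
    · have h1 := congrArg Prod.fst h
      have h2 := congrArg Prod.snd h
      simp only [Prod.fst_add, Prod.snd_add, Prod.smul_fst, Prod.smul_snd, smul_eq_mul] at h1 h2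
      apply hw
      simp only [cross, Prod.fst_sub, Prod.snd_sub]
      linear_combination -w.2 * h1 + w.1 * h2
    · have h0 : (i + 1) • w = 0 := by
        rw [add_assoc] at h
        rw [add_smul, one_smul, add_comm]
        exact left_eq_add.mp h
      rcases smul_eq_zero.mp h0 with h | h
      · omega
      · subst h
        simp [cross] at hw

/-- Size conditions on the numbers `p` and `q` of fjords. -/
structure FjordParams (n p q : ℤ) : Prop where
  nine_le : 9 ≤ n
  two_le_left : 2 ≤ p
  two_le_right : 2 ≤ q
  left_le : 3 * p ≤ n
  right_le : 3 * q ≤ n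

/-- The least first coordinate on the diagonal `x + y = c` of the part of the grid covered by the
main path. -/
def diagLo (n c : ℤ) : ℤ := max 1 (c - n)

/-- The greatest first coordinate on the diagonal `x + y = c` of the part of the grid covered by
the main path. -/
def diagHi (n p q c : ℤ) : ℤ :=
  min (c - 2 - if 4 ≤ c ∧ c ≤ p + 3 then 1 else 0)
    (n - 1 - if 2 * n - 1 - q ≤ c ∧ c ≤ 2 * n - 2 then 1 else 0)

/-- The width of the strip between the diagonals `x + y = c` and `x + y = c + 1`. -/
def stripWidth (n p q c : ℤ) : ℤ := diagHi n p q (c + 1) - diagLo n c + 1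

/-- The number of points on either side of the zigzag between the diagonals `x + y = c` and
`x + y = c + 1`. -/
def zigzagSize (n p q c : ℤ) : ℤ := (stripWidth n p q c + 2) / 3

/-- The first coordinate of the point where the main path enters the middle part of the diagonal
`x + y = c`. -/
def entry (n p q c : ℤ) : ℤ := diagHi n p q c - zigzagSize n p q (c - 1) + 1

/-- The first coordinate of the point where the main path leaves the middle part of the diagonal
`x + y = c`. -/
def exitPoint (n p q c : ℤ) : ℤ := diagLo n c + zigzagSize n p q c - 1

/-- The part of the main path between entering the middle of the diagonal `x + y = c` and entering
that of the next diagonal. -/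
def stripPath (n p q c : ℤ) : List LatticeEdge :=
  straightWalk (entry n p q c, c - entry n p q c) (-1, 1)
      (entry n p q c - exitPoint n p q c).toNat ++
    zigzag (exitPoint n p q c, c - exitPoint n p q c)
      (diagHi n p q (c + 1), c + 1 - diagHi n p q (c + 1)) (-1, 1)
      (2 * (zigzagSize n p q c - 1).toNat + 1)

/-- The main path through the first `k` strips. -/
def mainPath (n p q : ℤ) : ℕ → List LatticeEdge
  | 0 => []
  | k + 1 => mainPath n p q k ++ stripPath n p q (k + 3)

theorem one_le_zigzagSize {n p q c : ℤ} (h : FjordParams n p q) (hc : 2 ≤ c)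
    (hc' : c ≤ 2 * n - 2) : 1 ≤ zigzagSize n p q c := by
  obtain ⟨h1, h2, h3, h4, h5⟩ := h
  unfold zigzagSize stripWidth diagHi diagLo
  split_ifs <;> omega

theorem exitPoint_le_entry {n p q c : ℤ} (h : FjordParams n p q) (hc : 3 ≤ c)
    (hc' : c ≤ 2 * n - 2) : exitPoint n p q c ≤ entry n p q c := by
  obtain ⟨h1, h2, h3, h4, h5⟩ := h
  unfold exitPoint entry zigzagSize stripWidth diagHi diagLo
  split_ifs <;> omega

theorem diagLo_le_entry {n p q c : ℤ} (h : FjordParams n p q) (hc : 3 ≤ c)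
    (hc' : c ≤ 2 * n - 1) : diagLo n c ≤ entry n p q c := by
  obtain ⟨h1, h2, h3, h4, h5⟩ := h
  unfold entry zigzagSize stripWidth diagHi diagLo
  split_ifs <;> omega

theorem isEdgePath_stripPath {n p q c : ℤ} (h : FjordParams n p q) (hc : 3 ≤ c)
    (hc' : c ≤ 2 * n - 2) :
    IsEdgePath (entry n p q c, c - entry n p q c)
      (entry n p q (c + 1), c + 1 - entry n p q (c + 1)) (stripPath n p q c) := by
  have h1 := one_le_zigzagSize h (by omega) hc'
  have h2 := exitPoint_le_entry h hc hc'
  have he : entry n p q (c + 1) = diagHi n p q (c + 1) - zigzagSize n p q c + 1 := by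
    simp [entry]
  have hw := isEdgePath_straightWalk (entry n p q c, c - entry n p q c) (-1, 1)
    (entry n p q c - exitPoint n p q c).toNat
  have hz := isEdgePath_zigzag_odd (exitPoint n p q c, c - exitPoint n p q c)
    (diagHi n p q (c + 1), c + 1 - diagHi n p q (c + 1)) (-1, 1) (zigzagSize n p q c - 1).toNat
  have e1 : (entry n p q c, c - entry n p q c) +
      ((entry n p q c - exitPoint n p q c).toNat : ℤ) • ((-1, 1) : ℤ × ℤ) =
        (exitPoint n p q c, c - exitPoint n p q c) := by
    ext <;> simp only [Prod.fst_add, Prod.snd_add, Prod.smul_fst, Prod.smul_snd, smul_eq_mul] <;>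
      omega
  have e2 : (diagHi n p q (c + 1), c + 1 - diagHi n p q (c + 1)) +
      ((zigzagSize n p q c - 1).toNat : ℤ) • ((-1, 1) : ℤ × ℤ) =
        (entry n p q (c + 1), c + 1 - entry n p q (c + 1)) := by
    ext <;> simp only [Prod.fst_add, Prod.snd_add, Prod.smul_fst, Prod.smul_snd, smul_eq_mul] <;>
      omega
  rw [e1] at hw
  rw [e2] at hz
  exact hw.append hz

theorem mem_map_fst_stripPath {n p q c : ℤ} (h : FjordParams n p q) (hc : 3 ≤ c)
    (hc' : c ≤ 2 * n - 2) {z : ℤ × ℤ} :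
    z ∈ (stripPath n p q c).map Prod.fst ↔
      (z.1 + z.2 = c ∧ diagLo n c ≤ z.1 ∧ z.1 ≤ entry n p q c) ∨
        (z.1 + z.2 = c + 1 ∧ entry n p q (c + 1) < z.1 ∧ z.1 ≤ diagHi n p q (c + 1)) := by
  have h1 := one_le_zigzagSize h (by omega) hc'
  have h2 := exitPoint_le_entry h hc hc'
  obtain ⟨x, y⟩ := z
  rw [stripPath, List.map_append, List.mem_append, mem_map_fst_straightWalk, mem_map_fst_zigzag]
  have he : entry n p q (c + 1) = diagHi n p q (c + 1) - zigzagSize n p q c + 1 := by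
    simp [entry]
  have hx : exitPoint n p q c = diagLo n c + zigzagSize n p q c - 1 := rfl
  rw [he]
  simp only [Prod.ext_iff, Prod.fst_add, Prod.snd_add, Prod.smul_fst, Prod.smul_snd, smul_eq_mul]
  generalize entry n p q c = s at *
  generalize exitPoint n p q c = t at *
  generalize diagHi n p q (c + 1) = r at *
  generalize zigzagSize n p q c = j at *
  generalize diagLo n c = l at *
  constructor
  · rintro (⟨i, hi, hi', e1, e2⟩ | ⟨i, hi, ⟨hi', e1, e2⟩ | ⟨hi', e1, e2⟩⟩) <;> omega
  · rintro (⟨e, e1, e2⟩ | ⟨e, e1, e2⟩)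
    · by_cases hxt : t < x
      · exact Or.inl ⟨s - x, by omega, by omega, by omega, by omega⟩
      · exact Or.inr ⟨t - x, by omega, Or.inl ⟨by omega, by omega, by omega⟩⟩
    · exact Or.inr ⟨r - x, by omega, Or.inr ⟨by omega, by omega, by omega⟩⟩

theorem cross_stripPath (t r c : ℤ) : cross ((r, c + 1 - r) - (t, c - t)) (-1, 1) = 1 := by
  simp only [cross, Prod.fst_sub, Prod.snd_sub]
  ring

theorem isPrimitiveEdge_of_mem_stripPath {n p q c : ℤ} {e : LatticeEdge}
    (he : e ∈ stripPath n p q c) : IsPrimitiveEdge e := by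
  rcases List.mem_append.mp he with he | he
  · exact isPrimitiveEdge_of_mem_straightWalk ⟨0, 1, by simp⟩ he
  · refine isPrimitiveEdge_of_mem_zigzag ?_ he
    rw [cross_stripPath]
    exact isUnit_one

theorem stripPath_edge_mem {n p q c : ℤ} (h : FjordParams n p q) (hc : 3 ≤ c)
    (hc' : c ≤ 2 * n - 2) {e : LatticeEdge} (he : e ∈ stripPath n p q c) :
    ∀ z, z = e.1 ∨ z = e.2 →
      (z.1 + z.2 = c ∧ diagLo n c ≤ z.1 ∧ z.1 ≤ diagHi n p q c) ∨
        (z.1 + z.2 = c + 1 ∧ diagLo n (c + 1) ≤ z.1 ∧ z.1 ≤ diagHi n p q (c + 1)) := by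
  have h1 := one_le_zigzagSize h (by omega) hc'
  have h1' := one_le_zigzagSize h (c := c - 1) (by omega) (by omega)
  have h2 := exitPoint_le_entry h hc hc'
  have h3 := diagLo_le_entry h (c := c + 1) (by omega) (by omega)
  have he1 : entry n p q (c + 1) = diagHi n p q (c + 1) - zigzagSize n p q c + 1 := by
    simp [entry]
  have hx : exitPoint n p q c = diagLo n c + zigzagSize n p q c - 1 := rfl
  have he2 : entry n p q c = diagHi n p q c - zigzagSize n p q (c - 1) + 1 := rfl
  rw [stripPath, List.mem_append, mem_straightWalk, mem_zigzag] at he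
  generalize entry n p q c = s at *
  generalize exitPoint n p q c = t at *
  generalize entry n p q (c + 1) = s' at *
  generalize diagHi n p q (c + 1) = r at *
  generalize diagHi n p q c = r' at *
  generalize zigzagSize n p q c = j at *
  generalize zigzagSize n p q (c - 1) = j' at *
  generalize diagLo n c = l at *
  generalize diagLo n (c + 1) = l' at *
  rcases he with ⟨i, hi, hi', rfl⟩ | ⟨i, hi, ⟨hi', rfl⟩ | ⟨hi', rfl⟩⟩ <;>
    rintro z (rfl | rfl) <;>
    simp only [Prod.fst_add, Prod.snd_add, Prod.smul_fst, Prod.smul_snd, smul_eq_mul] <;>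
    omega

theorem stripPath_edge_sum {n p q c : ℤ} {e : LatticeEdge} (he : e ∈ stripPath n p q c) :
    c ≤ e.1.1 + e.1.2 ∧ e.1.1 + e.1.2 ≤ c + 1 ∧ c ≤ e.2.1 + e.2.2 ∧ e.2.1 + e.2.2 ≤ c + 1 ∧
      2 * c ≤ (e.1.1 + e.1.2) + (e.2.1 + e.2.2) ∧
      (e.1.1 + e.1.2) + (e.2.1 + e.2.2) ≤ 2 * c + 1 := by
  rw [stripPath, List.mem_append, mem_straightWalk, mem_zigzag] at he
  rcases he with ⟨i, hi, hi', rfl⟩ | ⟨i, hi, ⟨hi', rfl⟩ | ⟨hi', rfl⟩⟩ <;>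
    simp only [Prod.fst_add, Prod.snd_add, Prod.smul_fst, Prod.smul_snd, smul_eq_mul] <;>
    omega

theorem pairwise_stripPath (n p q c : ℤ) : (stripPath n p q c).Pairwise WeaklySeparated := by
  rw [stripPath, List.pairwise_append]
  refine ⟨pairwise_straightWalk (by simp) _ _,
    pairwise_zigzag (by rw [cross_stripPath]; exact one_ne_zero) _, ?_⟩
  intro e he e' he'
  rw [mem_straightWalk] at he
  rw [mem_zigzag] at he'
  obtain ⟨i, hi, hi', rfl⟩ := he
  refine ⟨1, 1, c, ?_⟩
  obtain ⟨j, hj, ⟨hj', rfl⟩ | ⟨hj', rfl⟩⟩ := he' <;>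
    simp only [Prod.fst_add, Prod.snd_add, Prod.smul_fst, Prod.smul_snd, smul_eq_mul] <;>
    omega

theorem nodup_map_fst_stripPath (n p q c : ℤ) : ((stripPath n p q c).map Prod.fst).Nodup := by
  rw [stripPath, List.map_append, List.nodup_append']
  refine ⟨nodup_map_fst_straightWalk (by simp) _ _,
    nodup_map_fst_zigzag (by rw [cross_stripPath]; exact one_ne_zero) _, ?_⟩
  intro z hz hz'
  rw [mem_map_fst_straightWalk] at hz
  rw [mem_map_fst_zigzag] at hz'
  simp only [Prod.ext_iff, Prod.fst_add, Prod.snd_add, Prod.smul_fst, Prod.smul_snd,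
    smul_eq_mul] at hz hz'
  obtain ⟨i, hi, hi', e1, e2⟩ := hz
  obtain ⟨j, hj, ⟨hj', e3, e4⟩ | ⟨hj', e3, e4⟩⟩ := hz' <;> omega

theorem isEdgePath_mainPath {n p q : ℤ} (h : FjordParams n p q) (k : ℕ)
    (hk : (k : ℤ) ≤ 2 * n - 4) :
    IsEdgePath (entry n p q 3, 3 - entry n p q 3)
      (entry n p q (k + 3), k + 3 - entry n p q (k + 3)) (mainPath n p q k) := by
  induction k with
  | zero => simp [mainPath, IsEdgePath]
  | succ k ih =>
    push_cast at hk ⊢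
    rw [show (k : ℤ) + 1 + 3 = k + 3 + 1 by ring]
    exact (ih (by omega)).append (isEdgePath_stripPath h (by omega) (by omega))

theorem mem_map_fst_mainPath {n p q : ℤ} (h : FjordParams n p q) (k : ℕ)
    (hk : (k : ℤ) ≤ 2 * n - 4) {z : ℤ × ℤ} :
    z ∈ (mainPath n p q k).map Prod.fst ↔ 3 ≤ z.1 + z.2 ∧ diagLo n (z.1 + z.2) ≤ z.1 ∧
      z.1 ≤ diagHi n p q (z.1 + z.2) ∧
      (z.1 + z.2 < k + 3 ∨ z.1 + z.2 = k + 3 ∧ entry n p q (k + 3) < z.1) := by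
  induction k with
  | zero =>
    have h1 : entry n p q 3 = diagHi n p q 3 := by
      obtain ⟨h1, h2, h3, h4, h5⟩ := h
      unfold entry zigzagSize stripWidth diagHi diagLo
      split_ifs <;> omega
    simp only [mainPath, List.map_nil, List.not_mem_nil, false_iff, Nat.cast_zero, zero_add, h1]
    rintro ⟨h1, h2, h3, h4 | ⟨h4, h5⟩⟩
    · omega
    · rw [h4] at h3
      omega
  | succ k ih =>
    push_cast at hk ⊢
    rw [mainPath, List.map_append, List.mem_append, ih (by omega),
      mem_map_fst_stripPath h (by omega) (by omega)]
    have h3 := diagLo_le_entry h (c := k + 3) (by omega) (by omega)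
    have h4 := diagLo_le_entry h (c := k + 4) (by omega) (by omega)
    have h1 := one_le_zigzagSize h (c := k + 2) (by omega) (by omega)
    have he : entry n p q (k + 3) = diagHi n p q (k + 3) - zigzagSize n p q (k + 2) + 1 := by
      simp only [entry]
      ring_nf
    have e1 : (k : ℤ) + 3 + 1 = k + 4 := by ring
    have e2 : (k : ℤ) + 1 + 3 = k + 4 := by ring
    rw [e1, e2]
    obtain ⟨x, y⟩ := z
    dsimp only
    by_cases hu : x + y = k + 3
    · rw [hu]
      omega
    by_cases hu' : x + y = k + 4
    · rw [hu']
      omega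
    · omega

theorem isPrimitiveEdge_of_mem_mainPath {n p q : ℤ} {k : ℕ} {e : LatticeEdge}
    (he : e ∈ mainPath n p q k) : IsPrimitiveEdge e := by
  induction k with
  | zero => simp [mainPath] at he
  | succ k ih =>
    rcases List.mem_append.mp he with he | he
    exacts [ih he, isPrimitiveEdge_of_mem_stripPath he]

theorem mainPath_edge_sum {n p q : ℤ} {k : ℕ} {e : LatticeEdge} (he : e ∈ mainPath n p q k) :
    e.1.1 + e.1.2 ≤ k + 3 ∧ e.2.1 + e.2.2 ≤ k + 3 ∧
      (e.1.1 + e.1.2) + (e.2.1 + e.2.2) ≤ 2 * k + 5 := by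
  induction k with
  | zero => simp [mainPath] at he
  | succ k ih =>
    push_cast
    rcases List.mem_append.mp he with he | he
    · have := ih he
      omega
    · have := stripPath_edge_sum he
      omega

theorem mainPath_edge_mem {n p q : ℤ} (h : FjordParams n p q) {k : ℕ}
    (hk : (k : ℤ) ≤ 2 * n - 4) {e : LatticeEdge} (he : e ∈ mainPath n p q k) {z : ℤ × ℤ}
    (hz : z = e.1 ∨ z = e.2) : 1 ≤ z.1 ∧ z.1 ≤ n - 1 ∧ 2 ≤ z.2 ∧ z.2 ≤ n := by
  induction k with
  | zero => simp [mainPath] at he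
  | succ k ih =>
    push_cast at hk
    rcases List.mem_append.mp he with he | he
    · exact ih (by omega) he
    · have hmem := stripPath_edge_mem h (by omega) (by omega) he z hz
      unfold diagLo diagHi at hmem
      split_ifs at hmem <;> omega

theorem pairwise_mainPath (n p q : ℤ) (k : ℕ) : (mainPath n p q k).Pairwise WeaklySeparated := by
  induction k with
  | zero => exact List.Pairwise.nil
  | succ k ih =>
    refine List.pairwise_append.mpr ⟨ih, pairwise_stripPath _ _ _ _, fun e he e' he' => ?_⟩
    have h1 := mainPath_edge_sum he
    have h2 := stripPath_edge_sum he'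
    exact ⟨1, 1, k + 3, by omega, by omega, by omega, by omega, by omega⟩

theorem nodup_map_fst_mainPath {n p q : ℤ} (h : FjordParams n p q) (k : ℕ)
    (hk : (k : ℤ) ≤ 2 * n - 4) : ((mainPath n p q k).map Prod.fst).Nodup := by
  induction k with
  | zero => exact List.nodup_nil
  | succ k ih =>
    push_cast at hk
    rw [mainPath, List.map_append, List.nodup_append']
    refine ⟨ih (by omega), nodup_map_fst_stripPath _ _ _ _, fun z hz hz' => ?_⟩
    rw [mem_map_fst_mainPath h k (by omega)] at hz
    rw [mem_map_fst_stripPath h (by omega) (by omega)] at hz'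
    omega

/-- The part of the polygon consisting of the last column and of the fjords to the right. -/
def rightPath (n q : ℤ) : List LatticeEdge :=
  straightWalk (n, n) (0, -1) (n - q - 1).toNat ++
    zigzag (n, q + 1) (n - 1, n - 1) (0, -1) (2 * q.toNat)

/-- The part of the polygon consisting of the first row and of the fjords at the bottom. -/
def bottomPath (n p : ℤ) : List LatticeEdge :=
  zigzag (n, 1) (p + 1, 2) (-1, 0) (2 * p.toNat) ++
    straightWalk (n - p, 1) (-1, 0) (n - p - 1).toNat

/-- The grid polygon with `p` fjords at the bottom and `q` fjords to the right. -/
def fjordPolygon (n p q : ℤ) : List LatticeEdge :=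
  mainPath n p q (2 * n - 4).toNat ++ ([((n - 1, n), (n, n))] ++ (rightPath n q ++
    (bottomPath n p ++ [((1, 1), (1, 2))])))

theorem cross_right (n q : ℤ) : cross ((n - 1, n - 1) - (n, q + 1)) (0, -1) = 1 := by
  simp only [cross, Prod.fst_sub, Prod.snd_sub]
  ring

theorem cross_bottom (n p : ℤ) : cross ((p + 1, 2) - (n, 1)) (-1, 0) = 1 := by
  simp only [cross, Prod.fst_sub, Prod.snd_sub]
  ring

theorem entry_three {n p q : ℤ} (h : FjordParams n p q) : entry n p q 3 = 1 := by
  obtain ⟨h1, h2, h3, h4, h5⟩ := h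
  unfold entry zigzagSize stripWidth diagHi diagLo
  split_ifs <;> omega

theorem entry_last {n p q : ℤ} (h : FjordParams n p q) : entry n p q (2 * n - 1) = n - 1 := by
  obtain ⟨h1, h2, h3, h4, h5⟩ := h
  unfold entry zigzagSize stripWidth diagHi diagLo
  split_ifs <;> omega

theorem isEdgePath_rightPath {n q : ℤ} (hq : 0 ≤ q) (hn : q + 1 ≤ n) :
    IsEdgePath (n, n) (n, 1) (rightPath n q) := by
  have hw := isEdgePath_straightWalk (n, n) (0, -1) (n - q - 1).toNat
  have hz := isEdgePath_zigzag_even (n, q + 1) (n - 1, n - 1) (0, -1) q.toNat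
  have e1 : (n, n) + ((n - q - 1).toNat : ℤ) • ((0, -1) : ℤ × ℤ) = (n, q + 1) := by
    ext <;> simp only [Prod.fst_add, Prod.snd_add, Prod.smul_fst, Prod.smul_snd, smul_eq_mul] <;>
      omega
  have e2 : (n, q + 1) + (q.toNat : ℤ) • ((0, -1) : ℤ × ℤ) = (n, 1) := by
    ext <;> simp only [Prod.fst_add, Prod.snd_add, Prod.smul_fst, Prod.smul_snd, smul_eq_mul] <;>
      omega
  rw [e1] at hw
  rw [e2] at hz
  exact hw.append hz

theorem isEdgePath_bottomPath {n p : ℤ} (hp : 0 ≤ p) (hn : p + 1 ≤ n) :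
    IsEdgePath (n, 1) (1, 1) (bottomPath n p) := by
  have hz := isEdgePath_zigzag_even (n, 1) (p + 1, 2) (-1, 0) p.toNat
  have hw := isEdgePath_straightWalk (n - p, 1) (-1, 0) (n - p - 1).toNat
  have e1 : (n - p, 1) + ((n - p - 1).toNat : ℤ) • ((-1, 0) : ℤ × ℤ) = (1, 1) := by
    ext <;> simp only [Prod.fst_add, Prod.snd_add, Prod.smul_fst, Prod.smul_snd, smul_eq_mul] <;>
      omega
  have e2 : (n, 1) + (p.toNat : ℤ) • ((-1, 0) : ℤ × ℤ) = (n - p, 1) := by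
    ext <;> simp only [Prod.fst_add, Prod.snd_add, Prod.smul_fst, Prod.smul_snd, smul_eq_mul] <;>
      omega
  rw [e1] at hw
  rw [e2] at hz
  exact hz.append hw

theorem isEdgePath_fjordPolygon {n p q : ℤ} (h : FjordParams n p q) :
    IsEdgePath (1, 2) (1, 2) (fjordPolygon n p q) := by
  have hm := isEdgePath_mainPath h (2 * n - 4).toNat (by have := h.nine_le; omega)
  rw [show ((2 * n - 4).toNat : ℤ) + 3 = 2 * n - 1 by have := h.nine_le; omega, entry_last h,
    entry_three h, show 2 * n - 1 - (n - 1) = n by ring] at hm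
  obtain ⟨h1, h2, h3, h4, h5⟩ := h
  refine IsEdgePath.append hm (IsEdgePath.append (b := (n, n)) ⟨rfl, rfl⟩ (IsEdgePath.append
    (isEdgePath_rightPath (by omega) (by omega)) (IsEdgePath.append
      (isEdgePath_bottomPath (by omega) (by omega)) ⟨rfl, rfl⟩)))

theorem mem_map_fst_rightPath {n q : ℤ} (hq : 0 ≤ q) (hn : q + 1 ≤ n) {z : ℤ × ℤ} :
    z ∈ (rightPath n q).map Prod.fst ↔
      (z.1 = n ∧ 2 ≤ z.2 ∧ z.2 ≤ n) ∨ (z.1 = n - 1 ∧ n - q ≤ z.2 ∧ z.2 ≤ n - 1) := by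
  obtain ⟨x, y⟩ := z
  rw [rightPath, List.map_append, List.mem_append, mem_map_fst_straightWalk, mem_map_fst_zigzag]
  simp only [Prod.ext_iff, Prod.fst_add, Prod.snd_add, Prod.smul_fst, Prod.smul_snd, smul_eq_mul]
  constructor
  · rintro (⟨i, hi, hi', e1, e2⟩ | ⟨i, hi, ⟨hi', e1, e2⟩ | ⟨hi', e1, e2⟩⟩) <;> omega
  · rintro (⟨e, e1, e2⟩ | ⟨e, e1, e2⟩)
    · by_cases hy : q + 1 < y
      · exact Or.inl ⟨n - y, by omega, by omega, by omega, by omega⟩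
      · exact Or.inr ⟨q + 1 - y, by omega, Or.inl ⟨by omega, by omega, by omega⟩⟩
    · exact Or.inr ⟨n - 1 - y, by omega, Or.inr ⟨by omega, by omega, by omega⟩⟩

theorem mem_map_fst_bottomPath {n p : ℤ} (hp : 0 ≤ p) (hn : p + 1 ≤ n) {z : ℤ × ℤ} :
    z ∈ (bottomPath n p).map Prod.fst ↔
      (z.2 = 1 ∧ 2 ≤ z.1 ∧ z.1 ≤ n) ∨ (z.2 = 2 ∧ 2 ≤ z.1 ∧ z.1 ≤ p + 1) := by
  obtain ⟨x, y⟩ := z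
  rw [bottomPath, List.map_append, List.mem_append, mem_map_fst_straightWalk, mem_map_fst_zigzag]
  simp only [Prod.ext_iff, Prod.fst_add, Prod.snd_add, Prod.smul_fst, Prod.smul_snd, smul_eq_mul]
  constructor
  · rintro (⟨i, hi, ⟨hi', e1, e2⟩ | ⟨hi', e1, e2⟩⟩ | ⟨i, hi, hi', e1, e2⟩) <;> omega
  · rintro (⟨e, e1, e2⟩ | ⟨e, e1, e2⟩)
    · by_cases hx : n - p < x
      · exact Or.inl ⟨n - x, by omega, Or.inl ⟨by omega, by omega, by omega⟩⟩
      · exact Or.inr ⟨n - p - x, by omega, by omega, by omega, by omega⟩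
    · exact Or.inl ⟨p + 1 - x, by omega, Or.inr ⟨by omega, by omega, by omega⟩⟩

theorem mem_map_fst_mainPath_last {n p q : ℤ} (h : FjordParams n p q) {z : ℤ × ℤ} :
    z ∈ (mainPath n p q (2 * n - 4).toNat).map Prod.fst ↔
      1 ≤ z.1 ∧ z.1 ≤ n - 1 ∧ 2 ≤ z.2 ∧ z.2 ≤ n ∧ ¬ (z.2 = 2 ∧ 2 ≤ z.1 ∧ z.1 ≤ p + 1) ∧
        ¬ (z.1 = n - 1 ∧ n - q ≤ z.2) := by
  rw [mem_map_fst_mainPath h _ (by have := h.nine_le; omega),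
    show ((2 * n - 4).toNat : ℤ) + 3 = 2 * n - 1 by have := h.nine_le; omega, entry_last h]
  obtain ⟨h1, h2, h3, h4, h5⟩ := h
  obtain ⟨x, y⟩ := z
  unfold diagLo diagHi
  dsimp only
  split_ifs <;> omega

theorem mem_map_fst_fjordPolygon {n : ℕ} {p q : ℤ} (h : FjordParams n p q) (z : ℤ × ℤ) :
    z ∈ (fjordPolygon n p q).map Prod.fst ↔ z ∈ gridSet n := by
  have hm := mem_map_fst_mainPath_last h (z := z)
  obtain ⟨h1, h2, h3, h4, h5⟩ := h
  have hr := mem_map_fst_rightPath (n := n) (q := q) (by omega) (by omega) (z := z)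
  have hb := mem_map_fst_bottomPath (n := n) (p := p) (by omega) (by omega) (z := z)
  simp only [fjordPolygon, List.map_append, List.mem_append, hm, hr, hb, List.map_cons,
    List.map_nil, List.mem_singleton, gridSet, Set.mem_ofPred_eq]
  obtain ⟨x, y⟩ := z
  simp only [Prod.mk.injEq]
  omega

theorem nodup_map_fst_fjordPolygon {n p q : ℤ} (h : FjordParams n p q) :
    ((fjordPolygon n p q).map Prod.fst).Nodup := by
  have hm := fun z => mem_map_fst_mainPath_last h (z := z)
  have hmn := nodup_map_fst_mainPath h (2 * n - 4).toNat (by have := h.nine_le; omega)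
  obtain ⟨h1, h2, h3, h4, h5⟩ := h
  have hr := fun z => mem_map_fst_rightPath (n := n) (q := q) (by omega) (by omega) (z := z)
  have hb := fun z => mem_map_fst_bottomPath (n := n) (p := p) (by omega) (by omega) (z := z)
  have hrn : ((rightPath n q).map Prod.fst).Nodup := by
    rw [rightPath, List.map_append, List.nodup_append']
    refine ⟨nodup_map_fst_straightWalk (by simp) _ _,
      nodup_map_fst_zigzag (by rw [cross_right]; exact one_ne_zero) _, fun z hz hz' => ?_⟩
    rw [mem_map_fst_straightWalk] at hz
    rw [mem_map_fst_zigzag] at hz'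
    simp only [Prod.ext_iff, Prod.fst_add, Prod.snd_add, Prod.smul_fst, Prod.smul_snd,
      smul_eq_mul] at hz hz'
    obtain ⟨i, hi, hi', e1, e2⟩ := hz
    obtain ⟨j, hj, ⟨hj', e3, e4⟩ | ⟨hj', e3, e4⟩⟩ := hz' <;> omega
  have hbn : ((bottomPath n p).map Prod.fst).Nodup := by
    rw [bottomPath, List.map_append, List.nodup_append']
    refine ⟨nodup_map_fst_zigzag (by rw [cross_bottom]; exact one_ne_zero) _,
      nodup_map_fst_straightWalk (by simp) _ _, fun z hz hz' => ?_⟩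
    rw [mem_map_fst_zigzag] at hz
    rw [mem_map_fst_straightWalk] at hz'
    simp only [Prod.ext_iff, Prod.fst_add, Prod.snd_add, Prod.smul_fst, Prod.smul_snd,
      smul_eq_mul] at hz hz'
    obtain ⟨i, hi, hi', e1, e2⟩ := hz'
    obtain ⟨j, hj, ⟨hj', e3, e4⟩ | ⟨hj', e3, e4⟩⟩ := hz <;> omega
  simp only [fjordPolygon, List.map_append, List.map_cons, List.map_nil]
  refine List.nodup_append'.mpr ⟨hmn, List.nodup_append'.mpr ⟨List.nodup_singleton _,
    List.nodup_append'.mpr ⟨hrn, List.nodup_append'.mpr ⟨hbn, List.nodup_singleton _, ?_⟩, ?_⟩,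
      ?_⟩, ?_⟩ <;>
    intro z hz hz' <;>
    simp only [List.mem_append, List.mem_singleton, hm, hr, hb, Prod.ext_iff] at hz hz' <;>
    omega

theorem isPrimitiveEdge_of_mem_fjordPolygon {n p q : ℤ} {e : LatticeEdge}
    (he : e ∈ fjordPolygon n p q) : IsPrimitiveEdge e := by
  simp only [fjordPolygon, rightPath, bottomPath, List.mem_append, List.mem_singleton] at he
  rcases he with he | rfl | (he | he) | (he | he) | rfl
  · exact isPrimitiveEdge_of_mem_mainPath he
  · exact ⟨1, 0, by ring⟩
  · exact isPrimitiveEdge_of_mem_straightWalk ⟨0, -1, by ring⟩ he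
  · exact isPrimitiveEdge_of_mem_zigzag (by rw [cross_right]; exact isUnit_one) he
  · exact isPrimitiveEdge_of_mem_zigzag (by rw [cross_bottom]; exact isUnit_one) he
  · exact isPrimitiveEdge_of_mem_straightWalk ⟨-1, 0, by ring⟩ he
  · exact ⟨0, 1, by ring⟩

theorem rightPath_edge {n q : ℤ} (hq : 0 ≤ q) (hn : q + 3 ≤ n) {e : LatticeEdge}
    (he : e ∈ rightPath n q) :
    n - 1 ≤ e.1.1 ∧ n - 1 ≤ e.2.1 ∧ 2 * n - 2 < e.1.1 + e.2.1 ∧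
      e.1.2 ≤ n ∧ e.2.2 ≤ n ∧ e.1.2 + e.2.2 < 2 * n ∧
      n + 1 ≤ e.1.1 + e.1.2 ∧ n + 1 ≤ e.2.1 + e.2.2 ∧
      2 * n + 2 < (e.1.1 + e.1.2) + (e.2.1 + e.2.2) := by
  rw [rightPath, List.mem_append, mem_straightWalk, mem_zigzag] at he
  rcases he with ⟨i, hi, hi', rfl⟩ | ⟨i, hi, ⟨hi', rfl⟩ | ⟨hi', rfl⟩⟩ <;>
    simp only [Prod.fst_add, Prod.snd_add, Prod.smul_fst, Prod.smul_snd, smul_eq_mul] <;>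
    omega

theorem bottomPath_edge {n p : ℤ} (hp : 0 ≤ p) (hn : p + 2 ≤ n) {e : LatticeEdge}
    (he : e ∈ bottomPath n p) :
    1 ≤ e.1.1 ∧ 1 ≤ e.2.1 ∧ 2 < e.1.1 + e.2.1 ∧
      e.1.2 ≤ 2 ∧ e.2.2 ≤ 2 ∧ e.1.2 + e.2.2 < 4 ∧
      e.1.1 + e.1.2 ≤ n + 1 ∧ e.2.1 + e.2.2 ≤ n + 1 := by
  rw [bottomPath, List.mem_append, mem_straightWalk, mem_zigzag] at he
  rcases he with ⟨i, hi, ⟨hi', rfl⟩ | ⟨hi', rfl⟩⟩ | ⟨i, hi, hi', rfl⟩ <;>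
    simp only [Prod.fst_add, Prod.snd_add, Prod.smul_fst, Prod.smul_snd, smul_eq_mul] <;>
    omega

theorem pairwise_rightPath (n q : ℤ) : (rightPath n q).Pairwise WeaklySeparated := by
  rw [rightPath, List.pairwise_append]
  refine ⟨pairwise_straightWalk (by simp) _ _,
    pairwise_zigzag (by rw [cross_right]; exact one_ne_zero) _, ?_⟩
  intro e he e' he'
  rw [mem_straightWalk] at he
  rw [mem_zigzag] at he'
  obtain ⟨i, hi, hi', rfl⟩ := he
  refine ⟨-1, 0, -n, ?_⟩
  obtain ⟨j, hj, ⟨hj', rfl⟩ | ⟨hj', rfl⟩⟩ := he' <;>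
    simp only [Prod.fst_add, Prod.snd_add, Prod.smul_fst, Prod.smul_snd, smul_eq_mul] <;>
    omega

theorem pairwise_bottomPath (n p : ℤ) : (bottomPath n p).Pairwise WeaklySeparated := by
  rw [bottomPath, List.pairwise_append]
  refine ⟨pairwise_zigzag (by rw [cross_bottom]; exact one_ne_zero) _,
    pairwise_straightWalk (by simp) _ _, ?_⟩
  intro e he e' he'
  rw [mem_zigzag] at he
  rw [mem_straightWalk] at he'
  obtain ⟨i, hi, hi', rfl⟩ := he'
  refine ⟨0, -1, -1, ?_⟩
  obtain ⟨j, hj, ⟨hj', rfl⟩ | ⟨hj', rfl⟩⟩ := he <;>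
    simp only [Prod.fst_add, Prod.snd_add, Prod.smul_fst, Prod.smul_snd, smul_eq_mul] <;>
    omega

theorem pairwise_fjordPolygon {n p q : ℤ} (h : FjordParams n p q) :
    (fjordPolygon n p q).Pairwise WeaklySeparated := by
  have hm : ∀ e ∈ mainPath n p q (2 * n - 4).toNat, e.1.1 ≤ n - 1 ∧ e.2.1 ≤ n - 1 ∧
      2 ≤ e.1.2 ∧ 2 ≤ e.2.2 := fun e he => by
    have hk : ((2 * n - 4).toNat : ℤ) ≤ 2 * n - 4 := by have := h.nine_le; omega
    have h1 := mainPath_edge_mem h hk he (Or.inl rfl)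
    have h2 := mainPath_edge_mem h hk he (Or.inr rfl)
    omega
  obtain ⟨h1, h2, h3, h4, h5⟩ := h
  have hr := fun e => rightPath_edge (n := n) (q := q) (by omega) (by omega) (e := e)
  have hb := fun e => bottomPath_edge (n := n) (p := p) (by omega) (by omega) (e := e)
  rw [fjordPolygon]
  refine List.pairwise_append.mpr ⟨pairwise_mainPath _ _ _ _, List.pairwise_append.mpr
    ⟨List.pairwise_singleton _ _, List.pairwise_append.mpr ⟨pairwise_rightPath _ _,
      List.pairwise_append.mpr ⟨pairwise_bottomPath _ _, List.pairwise_singleton _ _, ?_⟩, ?_⟩,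
        ?_⟩, ?_⟩ <;> intro e he e' he'
  · have := hb e he
    obtain rfl := List.mem_singleton.mp he'
    exact ⟨-1, 0, -1, by dsimp only; omega⟩
  · have := hr e he
    rcases List.mem_append.mp he' with he' | he'
    · have := hb e' he'
      exact ⟨-1, -1, -(n + 1), by omega⟩
    · obtain rfl := List.mem_singleton.mp he'
      exact ⟨-1, 0, -2, by dsimp only; omega⟩
  · obtain rfl := List.mem_singleton.mp he
    simp only [List.mem_append, List.mem_singleton] at he'
    rcases he' with he' | he' | rfl
    · have := hr e' he'
      exact ⟨0, -1, -n, by dsimp only; omega⟩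
    · have := hb e' he'
      exact ⟨0, -1, -n, by dsimp only; omega⟩
    · exact ⟨0, -1, -n, by dsimp only; omega⟩
  · have := hm e he
    simp only [List.mem_append, List.mem_singleton] at he'
    rcases he' with rfl | he' | he' | rfl
    · exact ⟨1, 0, n - 1, by dsimp only; omega⟩
    · have := hr e' he'
      exact ⟨1, 0, n - 1, by omega⟩
    · have := hb e' he'
      exact ⟨0, -1, -2, by omega⟩
    · exact ⟨0, -1, -2, by dsimp only; omega⟩

/-- The contribution of a strip of width `K` to the weight of the main path. -/
def stripGain (K : ℤ) : ℤ := (4 * ((K + 2) / 3) - 2) * (K - (K + 2) / 3) ^ 2 - 1 - 2 * K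

theorem stripGain_three_mul (s : ℤ) : stripGain (3 * s) = 16 * s ^ 3 - 8 * s ^ 2 - 6 * s - 1 := by
  rw [stripGain, show (3 * s + 2) / 3 = s by omega]
  ring

theorem stripGain_three_mul_add_one (s : ℤ) :
    stripGain (3 * s + 1) = 16 * s ^ 3 + 8 * s ^ 2 - 6 * s - 3 := by
  rw [stripGain, show (3 * s + 1 + 2) / 3 = s + 1 by omega]
  ring

theorem stripGain_three_mul_add_two (s : ℤ) :
    stripGain (3 * s + 2) = 16 * s ^ 3 + 24 * s ^ 2 + 6 * s - 3 := by
  rw [stripGain, show (3 * s + 2 + 2) / 3 = s + 1 by omega]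
  ring

/-- A closed form of the sum of `stripGain i + 2 * i` over `1 ≤ i ≤ m`. -/
def gainSum (m : ℤ) : ℤ :=
  12 * (m / 3) ^ 4 + if m % 3 = 0 then -2 * (m / 3) ^ 2 - 3 * (m / 3)
    else if m % 3 = 1 then 16 * (m / 3) ^ 3 + 6 * (m / 3) ^ 2 - 3 * (m / 3) - 1
    else 32 * (m / 3) ^ 3 + 30 * (m / 3) ^ 2 + 9 * (m / 3)

theorem gainSum_three_mul (s : ℤ) : gainSum (3 * s) = 12 * s ^ 4 - 2 * s ^ 2 - 3 * s := by
  rw [gainSum, show 3 * s / 3 = s by omega, if_pos (by omega)]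
  ring

theorem gainSum_three_mul_add_one (s : ℤ) :
    gainSum (3 * s + 1) = 12 * s ^ 4 + 16 * s ^ 3 + 6 * s ^ 2 - 3 * s - 1 := by
  rw [gainSum, show (3 * s + 1) / 3 = s by omega, if_neg (by omega), if_pos (by omega)]
  ring

theorem gainSum_three_mul_add_two (s : ℤ) :
    gainSum (3 * s + 2) = 12 * s ^ 4 + 32 * s ^ 3 + 30 * s ^ 2 + 9 * s := by
  rw [gainSum, show (3 * s + 2) / 3 = s by omega, if_neg (by omega), if_neg (by omega)]
  ring

theorem gainSum_add_one (m : ℤ) :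
    gainSum (m + 1) = gainSum m + stripGain (m + 1) + 2 * (m + 1) := by
  obtain ⟨s, rfl | rfl | rfl⟩ : ∃ s, m = 3 * s ∨ m = 3 * s + 1 ∨ m = 3 * s + 2 :=
    ⟨m / 3, by omega⟩
  · rw [gainSum_three_mul_add_one, gainSum_three_mul, stripGain_three_mul_add_one]
    ring
  · rw [show 3 * s + 1 + 1 = 3 * s + 2 by ring, gainSum_three_mul_add_two,
      gainSum_three_mul_add_one, stripGain_three_mul_add_two]
    ring
  · rw [show 3 * s + 2 + 1 = 3 * (s + 1) by ring, gainSum_three_mul_add_two,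
      gainSum_three_mul, stripGain_three_mul]
    ring

/-- The weight of a part of the main path, up to a telescoping term. -/
def stripWeight (n p q c : ℤ) : ℤ :=
  2 * (diagHi n p q c - diagLo n c + 1) + 2 + stripGain (stripWidth n p q c)

theorem totalWeight_stripPath {n p q c : ℤ} (h : FjordParams n p q) (hc : 3 ≤ c)
    (hc' : c ≤ 2 * n - 2) :
    totalWeight (stripPath n p q c) =
      stripWeight n p q c + 2 * zigzagSize n p q c - 2 * zigzagSize n p q (c - 1) := by
  have h1 := one_le_zigzagSize h (by omega) hc'
  have h2 := exitPoint_le_entry h hc hc'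
  have hK : diagHi n p q (c + 1) = stripWidth n p q c + diagLo n c - 1 := by
    rw [stripWidth]
    ring
  rw [stripPath, totalWeight_append, totalWeight_straightWalk, totalWeight_zigzag_odd,
    Int.toNat_of_nonneg (by omega), Int.toNat_of_nonneg (by omega), stripWeight, stripGain,
    entry, exitPoint, hK, ← zigzagSize]
  ring

theorem totalWeight_mainPath {n p q : ℤ} (h : FjordParams n p q) (k : ℕ)
    (hk : (k : ℤ) ≤ 2 * n - 4) :
    totalWeight (mainPath n p q k) = ∑ i ∈ Finset.range k, stripWeight n p q (i + 3) +
      2 * zigzagSize n p q (k + 2) - 2 * zigzagSize n p q 2 := by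
  induction k with
  | zero => simp [mainPath, totalWeight_nil]
  | succ k ih =>
    push_cast at hk ⊢
    rw [mainPath, totalWeight_append, ih (by omega),
      totalWeight_stripPath h (by omega) (by omega), Finset.sum_range_succ,
      show (k : ℤ) + 3 - 1 = k + 2 by ring, show (k : ℤ) + 1 + 2 = k + 3 by ring]
    ring

theorem stripWeight_eq {n p q c K l : ℤ} (hl : diagHi n p q c - diagLo n c + 1 = l)
    (hK : stripWidth n p q c = K) :
    stripWeight n p q c = 2 * l + 2 + stripGain K := by
  rw [stripWeight, hl, hK]

section Sum

variable {n p q : ℤ}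

theorem sum_stripWeight_of_le_left (h : FjordParams n p q) (k : ℕ) (hk : 1 ≤ (k : ℤ))
    (hk' : (k : ℤ) ≤ p) :
    ∑ i ∈ Finset.range k, stripWeight n p q (i + 3) = gainSum k + 2 := by
  induction k with
  | zero => simp at hk
  | succ k ih =>
    push_cast at hk' ⊢
    obtain ⟨h1, h2, h3, h4, h5⟩ := id h
    rw [Finset.sum_range_succ, gainSum_add_one]
    by_cases h0 : k = 0
    · subst h0
      rw [stripWeight_eq (l := 1) (K := 1)]
      · simp [show gainSum 0 = 0 by decide]
        ring
      · unfold diagHi diagLo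
        split_ifs <;> omega
      · unfold stripWidth diagHi diagLo
        split_ifs <;> omega
    · rw [ih (by omega) (by omega), stripWeight_eq (l := k) (K := k + 1)]
      · ring
      · unfold diagHi diagLo
        split_ifs <;> omega
      · unfold stripWidth diagHi diagLo
        split_ifs <;> omega

theorem sum_stripWeight_of_le_diag (h : FjordParams n p q) (k : ℕ) (hk : p + 1 ≤ (k : ℤ))
    (hk' : (k : ℤ) ≤ n - 2) :
    ∑ i ∈ Finset.range k, stripWeight n p q (i + 3) =
      gainSum (k + 1) - stripGain (p + 1) - 2 * p - 2 := by
  induction k with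
  | zero =>
    have := h.two_le_left
    simp at hk
    omega
  | succ k ih =>
    push_cast at hk hk' ⊢
    obtain ⟨h1, h2, h3, h4, h5⟩ := id h
    rw [Finset.sum_range_succ, gainSum_add_one]
    by_cases h0 : (k : ℤ) = p
    · rw [sum_stripWeight_of_le_left h k (by omega) (by omega), gainSum_add_one,
        stripWeight_eq (l := p) (K := p + 2), h0]
      · ring_nf
      · unfold diagHi diagLo
        split_ifs <;> omega
      · unfold stripWidth diagHi diagLo
        split_ifs <;> omega
    · rw [ih (by omega) (by omega), stripWeight_eq (l := k + 1) (K := k + 1 + 1)]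
      · ring
      · unfold diagHi diagLo
        split_ifs <;> omega
      · unfold stripWidth diagHi diagLo
        split_ifs <;> omega

theorem sum_stripWeight_of_diag_le (h : FjordParams n p q) (k : ℕ) (hk : n - 2 ≤ (k : ℤ))
    (hk' : (k : ℤ) ≤ 2 * n - 5 - q) :
    ∑ i ∈ Finset.range k, stripWeight n p q (i + 3) =
      2 * gainSum (n - 1) - stripGain (p + 1) - 2 * p - 2 - gainSum (2 * n - 3 - k) +
        2 * (k - n + 2) := by
  induction k with
  | zero =>
    have := h.nine_le
    simp at hk
    omega
  | succ k ih =>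
    push_cast at hk hk' ⊢
    obtain ⟨h1, h2, h3, h4, h5⟩ := id h
    by_cases h0 : (k : ℤ) + 1 = n - 2
    · rw [sum_stripWeight_of_le_diag h (k + 1) (by push_cast; omega) (by push_cast; omega)]
      push_cast
      rw [h0]
      ring_nf
    · have := gainSum_add_one (2 * n - 3 - (k + 1))
      rw [show 2 * n - 3 - ((k : ℤ) + 1) + 1 = 2 * n - 3 - k by ring] at this
      rw [Finset.sum_range_succ, ih (by omega) (by omega),
        stripWeight_eq (l := 2 * n - 3 - k) (K := 2 * n - 3 - k)]
      · linear_combination -this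
      · unfold diagHi diagLo
        split_ifs <;> omega
      · unfold stripWidth diagHi diagLo
        split_ifs <;> omega

theorem sum_stripWeight_of_right_le (h : FjordParams n p q) (k : ℕ)
    (hk : 2 * n - 4 - q ≤ (k : ℤ)) (hk' : (k : ℤ) ≤ 2 * n - 5) :
    ∑ i ∈ Finset.range k, stripWeight n p q (i + 3) =
      2 * gainSum (n - 1) - stripGain (p + 1) - 2 * p - stripGain (q + 2) - 2 * q - 4 +
        2 * (k - n + 2) - gainSum (2 * n - 4 - k) := by
  induction k with
  | zero =>
    have := h.nine_le
    have := h.right_le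
    simp at hk
    omega
  | succ k ih =>
    push_cast at hk hk' ⊢
    obtain ⟨h1, h2, h3, h4, h5⟩ := id h
    rw [Finset.sum_range_succ]
    by_cases h0 : (k : ℤ) + 1 = 2 * n - 4 - q
    · have e1 := gainSum_add_one q
      have e2 := gainSum_add_one (q + 1)
      rw [show q + 1 + 1 = q + 2 by ring] at e2
      rw [sum_stripWeight_of_diag_le h k (by omega) (by omega),
        stripWeight_eq (l := q + 2) (K := q + 1), show 2 * n - 3 - (k : ℤ) = q + 2 by omega,
        show 2 * n - 4 - ((k : ℤ) + 1) = q by omega]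
      · linear_combination -e1 - e2
      · unfold diagHi diagLo
        split_ifs <;> omega
      · unfold stripWidth diagHi diagLo
        split_ifs <;> omega
    · have := gainSum_add_one (2 * n - 4 - (k + 1))
      rw [show 2 * n - 4 - ((k : ℤ) + 1) + 1 = 2 * n - 4 - k by ring] at this
      rw [ih (by omega) (by omega), stripWeight_eq (l := 2 * n - 4 - k) (K := 2 * n - 4 - k)]
      · linear_combination -this
      · unfold diagHi diagLo
        split_ifs <;> omega
      · unfold stripWidth diagHi diagLo
        split_ifs <;> omega

theorem totalWeight_mainPath_last (h : FjordParams n p q) :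
    totalWeight (mainPath n p q (2 * n - 4).toNat) =
      2 * gainSum (n - 1) - stripGain (p + 1) - 2 * p - stripGain (q + 2) - 2 * q +
        2 * n - 8 := by
  have hk : ((2 * n - 5).toNat : ℤ) = 2 * n - 5 := by have := h.nine_le; omega
  rw [show (2 * n - 4).toNat = (2 * n - 5).toNat + 1 by have := h.nine_le; omega,
    totalWeight_mainPath h _ (by push_cast; omega), Finset.sum_range_succ,
    sum_stripWeight_of_right_le h _ (by have := h.two_le_right; omega) (by omega)]
  push_cast
  rw [hk]
  obtain ⟨h1, h2, h3, h4, h5⟩ := h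
  rw [stripWeight_eq (l := 1) (K := 2), show zigzagSize n p q (2 * n - 5 + 1 + 2) = 1 from ?_,
    show zigzagSize n p q 2 = 1 from ?_, show 2 * n - 4 - (2 * n - 5) = 1 by ring,
    show gainSum 1 = -1 by decide, show stripGain 2 = -3 by decide]
  · ring
  all_goals
    simp only [zigzagSize, stripWidth, diagHi, diagLo]
    split_ifs <;> omega

end Sum

theorem totalWeight_fjordPolygon {n p q : ℤ} (h : FjordParams n p q) :
    totalWeight (fjordPolygon n p q) =
      2 * gainSum (n - 1) - stripGain (p + 1) - stripGain (q + 2) + 4 * n - 8 - 3 * p - 3 * q +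
        p * ((n - p - 1) ^ 2 + (n - p - 2) ^ 2 + 2) +
        q * ((n - q - 1) ^ 2 + (n - q - 2) ^ 2 + 2) := by
  have hm := totalWeight_mainPath_last h
  obtain ⟨h1, h2, h3, h4, h5⟩ := h
  simp only [fjordPolygon, rightPath, bottomPath, totalWeight_append, totalWeight_cons,
    totalWeight_nil, totalWeight_straightWalk, totalWeight_zigzag_even, edgeWeight, hm]
  rw [Int.toNat_of_nonneg (by omega), Int.toNat_of_nonneg (by omega),
    Int.toNat_of_nonneg (by omega), Int.toNat_of_nonneg (by omega)]
  ring

theorem alphaSeq_eq_totalWeight (n : ℕ)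
    (h : FjordParams n (((n : ℤ) + 1) / 3 - 1) ((n : ℤ) / 3 - 1)) :
    alphaSeq n = totalWeight (fjordPolygon n (((n : ℤ) + 1) / 3 - 1) ((n : ℤ) / 3 - 1)) := by
  rw [totalWeight_fjordPolygon h, sub_add_cancel, show (n : ℤ) / 3 - 1 + 2 = n / 3 + 1 by ring]
  clear h
  have hr : n % 9 < 9 := Nat.mod_lt _ (by norm_num)
  obtain ⟨t, ht⟩ : ∃ t : ℤ, (n : ℤ) = 9 * t + (n % 9 : ℕ) := ⟨n / 9, by omega⟩
  have hq : (n : ℚ) = 9 * t + (n % 9 : ℕ) := by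
    rw [← Int.cast_natCast n, ht]
    push_cast
    rfl
  unfold alphaSeq cCorr
  generalize n % 9 = r at *
  interval_cases r <;> norm_num at hq ht ⊢
  · rw [show (n : ℤ) / 3 + 1 = 3 * t + 1 by omega, show (n : ℤ) / 3 = 3 * t by omega,
      show ((n : ℤ) + 1) / 3 = 3 * t by omega, show (n : ℤ) - 1 = 3 * (3 * t - 1) + 2 by omega,
      gainSum_three_mul_add_two, stripGain_three_mul, stripGain_three_mul_add_one]
    push_cast [hq]
    ring
  · rw [show (n : ℤ) / 3 + 1 = 3 * t + 1 by omega, show (n : ℤ) / 3 = 3 * t by omega,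
      show ((n : ℤ) + 1) / 3 = 3 * t by omega, show (n : ℤ) - 1 = 3 * (3 * t) by omega,
      gainSum_three_mul, stripGain_three_mul, stripGain_three_mul_add_one]
    push_cast [hq]
    ring
  · rw [show (n : ℤ) / 3 + 1 = 3 * t + 1 by omega, show (n : ℤ) / 3 = 3 * t by omega,
      show ((n : ℤ) + 1) / 3 = 3 * t + 1 by omega, show (n : ℤ) - 1 = 3 * (3 * t) + 1 by omega,
      gainSum_three_mul_add_one, stripGain_three_mul_add_one]
    push_cast [hq]
    ring
  · rw [show (n : ℤ) / 3 + 1 = 3 * t + 2 by omega, show (n : ℤ) / 3 = 3 * t + 1 by omega,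
      show ((n : ℤ) + 1) / 3 = 3 * t + 1 by omega, show (n : ℤ) - 1 = 3 * (3 * t) + 2 by omega,
      gainSum_three_mul_add_two, stripGain_three_mul_add_one, stripGain_three_mul_add_two]
    push_cast [hq]
    ring
  · rw [show (n : ℤ) / 3 + 1 = 3 * t + 2 by omega, show (n : ℤ) / 3 = 3 * t + 1 by omega,
      show ((n : ℤ) + 1) / 3 = 3 * t + 1 by omega, show (n : ℤ) - 1 = 3 * (3 * t + 1) by omega,
      gainSum_three_mul, stripGain_three_mul_add_one, stripGain_three_mul_add_two]
    push_cast [hq]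
    ring
  · rw [show (n : ℤ) / 3 + 1 = 3 * t + 2 by omega, show (n : ℤ) / 3 = 3 * t + 1 by omega,
      show ((n : ℤ) + 1) / 3 = 3 * t + 2 by omega, show (n : ℤ) - 1 = 3 * (3 * t + 1) + 1 by omega,
      gainSum_three_mul_add_one, stripGain_three_mul_add_two]
    push_cast [hq]
    ring
  · rw [show (n : ℤ) / 3 + 1 = 3 * (t + 1) by omega, show (n : ℤ) / 3 = 3 * t + 2 by omega,
      show ((n : ℤ) + 1) / 3 = 3 * t + 2 by omega, show (n : ℤ) - 1 = 3 * (3 * t + 1) + 2 by omega,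
      gainSum_three_mul_add_two, stripGain_three_mul, stripGain_three_mul_add_two]
    push_cast [hq]
    ring
  · rw [show (n : ℤ) / 3 + 1 = 3 * (t + 1) by omega, show (n : ℤ) / 3 = 3 * t + 2 by omega,
      show ((n : ℤ) + 1) / 3 = 3 * t + 2 by omega, show (n : ℤ) - 1 = 3 * (3 * t + 2) by omega,
      gainSum_three_mul, stripGain_three_mul, stripGain_three_mul_add_two]
    push_cast [hq]
    ring
  · rw [show (n : ℤ) / 3 + 1 = 3 * (t + 1) by omega, show (n : ℤ) / 3 = 3 * t + 2 by omega,
      show ((n : ℤ) + 1) / 3 = 3 * (t + 1) by omega, show (n : ℤ) - 1 = 3 * (3 * t + 2) + 1 by omega,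
      gainSum_three_mul_add_one, stripGain_three_mul]
    push_cast [hq]
    ring

/-- For every integer `n ≥ 9`, `a(n) ≥ α(n)`. -/
theorem polyA_ge_alpha (n : ℕ) (hn : 9 ≤ n) : alphaSeq n ≤ (polyA n : ℚ) := by
  have h : FjordParams n (((n : ℤ) + 1) / 3 - 1) ((n : ℤ) / 3 - 1) := by
    constructor <;> omega
  rw [alphaSeq_eq_totalWeight n h]
  exact_mod_cast totalWeight_le_polyA (by omega) (isEdgePath_fjordPolygon h)
    (nodup_map_fst_fjordPolygon h) (mem_map_fst_fjordPolygon h)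
    (fun e he => isPrimitiveEdge_of_mem_fjordPolygon he) (pairwise_fjordPolygon h)
end

section
/- For every integer n ≥ 6, one has a(n) ≥ β(n), where β(n) = (8/27)n⁴ − (32/27)n³ + (16/3)n² − 18n + 20 + d(n), with d(n) = 0 if n ≡ 0 (mod 3), d(n) = −(8n+4)/27 if n ≡ 1 (mod 3), and d(n) = −(16n−16)/27 if n ≡ 2 (mod 3). -/
namespace GridSnake

/-- The vector from `p` to `q` is primitive. -/
def Prim (p q : ℤ × ℤ) : Prop := ∃ A B : ℤ, A * (q.1 - p.1) + B * (q.2 - p.2) = 1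

/-- The segments `[p, p']` and `[q, q']` meet only in common endpoints. -/
def NonCrossing (p p' q q' : ℤ × ℤ) : Prop :=
  segment ℝ (toR2 p) (toR2 p') ∩ segment ℝ (toR2 q) (toR2 q') ⊆
    ({toR2 p, toR2 p'} : Set (ℝ × ℝ)) ∩ ({toR2 q, toR2 q'} : Set (ℝ × ℝ))

lemma NonCrossing.symm {p p' q q' : ℤ × ℤ} (h : NonCrossing p p' q q') :
    NonCrossing q q' p p' :=
  fun _ hx => (h hx.symm).symm

/-- A primitive segment contains no lattice points besides its endpoints. -/
lemma Prim.mem_of_mem_segment {p q r : ℤ × ℤ} (h : Prim p q)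
    (hr : toR2 r ∈ segment ℝ (toR2 p) (toR2 q)) : r = p ∨ r = q := by
  obtain ⟨A, B, hAB⟩ := h
  obtain ⟨a, b, ha, hb, hab, hr⟩ := hr
  obtain ⟨p1, p2⟩ := p
  obtain ⟨q1, q2⟩ := q
  obtain ⟨r1, r2⟩ := r
  simp only [toR2, Prod.smul_mk, smul_eq_mul, Prod.mk_add_mk, Prod.mk.injEq] at hr hAB
  obtain ⟨h1, h2⟩ := hr
  have hAB' : (A : ℝ) * (q1 - p1) + B * (q2 - p2) = 1 := by exact_mod_cast hAB
  have ha' : a = 1 - b := by linarith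
  subst ha'
  have hb' : b = ((A * (r1 - p1) + B * (r2 - p2) : ℤ) : ℝ) := by
    push_cast
    rw [← h1, ← h2]
    linear_combination (-b) * hAB'
  set t : ℤ := A * (r1 - p1) + B * (r2 - p2) with ht
  have ht0 : 0 ≤ t := by rw [hb'] at hb; exact_mod_cast hb
  have ht1 : t ≤ 1 := by rw [hb'] at ha; exact_mod_cast sub_nonneg.mp ha
  obtain h | h : t = 0 ∨ t = 1 := by omega
  · left
    rw [h] at hb'
    subst hb'
    ext
    · have : (p1 : ℝ) = r1 := by simpa using h1
      exact_mod_cast this.symm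
    · have : (p2 : ℝ) = r2 := by simpa using h2
      exact_mod_cast this.symm
  · right
    rw [h] at hb'
    subst hb'
    ext
    · have : (q1 : ℝ) = r1 := by simpa using h1
      exact_mod_cast this.symm
    · have : (q2 : ℝ) = r2 := by simpa using h2
      exact_mod_cast this.symm

/-- If a linear form is at most `C` at both endpoints of a segment, strictly at one of them, then
a point of the segment where the form is at least `C` is an endpoint. -/
lemma eq_endpoint_of_mem_segment {p q : ℤ × ℤ} {x : ℝ × ℝ} {A B C : ℤ}
    (hx : x ∈ segment ℝ (toR2 p) (toR2 q))
    (hp : A * p.1 + B * p.2 ≤ C) (hq : A * q.1 + B * q.2 ≤ C)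
    (hlt : A * p.1 + B * p.2 < C ∨ A * q.1 + B * q.2 < C)
    (hC : (C : ℝ) ≤ A * x.1 + B * x.2) : x = toR2 p ∨ x = toR2 q := by
  obtain ⟨a, b, ha, hb, hab, rfl⟩ := hx
  obtain ⟨p1, p2⟩ := p
  obtain ⟨q1, q2⟩ := q
  have ha' : a = 1 - b := by linarith
  subst ha'
  simp only [toR2, Prod.smul_mk, smul_eq_mul, Prod.mk_add_mk] at *
  have hp' : (A : ℝ) * p1 + B * p2 ≤ C := by exact_mod_cast hp
  have hq' : (A : ℝ) * q1 + B * q2 ≤ C := by exact_mod_cast hq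
  rcases hlt with h | h
  · right
    have h' : (A : ℝ) * p1 + B * p2 < C := by exact_mod_cast h
    have : b = 1 := by nlinarith
    subst this
    simp
  · left
    have h' : (A : ℝ) * q1 + B * q2 < C := by exact_mod_cast h
    have : b = 0 := by nlinarith
    subst this
    simp

lemma le_of_mem_segment {p q : ℤ × ℤ} {x : ℝ × ℝ} {A B C : ℤ}
    (hx : x ∈ segment ℝ (toR2 p) (toR2 q))
    (hp : A * p.1 + B * p.2 ≤ C) (hq : A * q.1 + B * q.2 ≤ C) :
    (A * x.1 + B * x.2 : ℝ) ≤ C := by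
  obtain ⟨a, b, ha, hb, hab, rfl⟩ := hx
  obtain ⟨p1, p2⟩ := p
  obtain ⟨q1, q2⟩ := q
  have ha' : a = 1 - b := by linarith
  subst ha'
  simp only [toR2, Prod.smul_mk, smul_eq_mul, Prod.mk_add_mk] at *
  have hp' : (A : ℝ) * p1 + B * p2 ≤ C := by exact_mod_cast hp
  have hq' : (A : ℝ) * q1 + B * q2 ≤ C := by exact_mod_cast hq
  nlinarith

lemma nonCrossing_of_lt {p p' q q' : ℤ × ℤ} (hq : Prim q q') (A B C : ℤ)
    (h1 : A * p.1 + B * p.2 ≤ C) (h2 : A * p'.1 + B * p'.2 ≤ C)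
    (h3 : C ≤ A * q.1 + B * q.2) (h4 : C ≤ A * q'.1 + B * q'.2)
    (h : A * p.1 + B * p.2 < C ∨ A * p'.1 + B * p'.2 < C) : NonCrossing p p' q q' := by
  rintro x ⟨hx1, hx2⟩
  have hC := le_of_mem_segment (A := -A) (B := -B) (C := -C) hx2 (by linarith) (by linarith)
  push_cast at hC
  have key : ∃ r, (r = p ∨ r = p') ∧ x = toR2 r := by
    rcases eq_endpoint_of_mem_segment hx1 h1 h2 h (by linarith) with h | h
    · exact ⟨p, Or.inl rfl, h⟩
    · exact ⟨p', Or.inr rfl, h⟩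
  obtain ⟨r, hr, rfl⟩ := key
  refine ⟨?_, ?_⟩
  · rcases hr with rfl | rfl <;> simp
  · rcases hq.mem_of_mem_segment hx2 with rfl | rfl <;> simp

/-- Two primitive segments weakly separated by a line that does not contain both of them meet only
in common endpoints. -/
lemma nonCrossing_of_separated {p p' q q' : ℤ × ℤ} (hp : Prim p p') (hq : Prim q q') (A B C : ℤ)
    (h1 : A * p.1 + B * p.2 ≤ C) (h2 : A * p'.1 + B * p'.2 ≤ C)
    (h3 : C ≤ A * q.1 + B * q.2) (h4 : C ≤ A * q'.1 + B * q'.2)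
    (h : A * p.1 + B * p.2 < C ∨ A * p'.1 + B * p'.2 < C ∨
      C < A * q.1 + B * q.2 ∨ C < A * q'.1 + B * q'.2) : NonCrossing p p' q q' := by
  rcases h with h | h | h | h
  · exact nonCrossing_of_lt hq A B C h1 h2 h3 h4 (Or.inl h)
  · exact nonCrossing_of_lt hq A B C h1 h2 h3 h4 (Or.inr h)
  · exact (nonCrossing_of_lt hp (-A) (-B) (-C) (by linarith) (by linarith) (by linarith)
      (by linarith) (Or.inl (by linarith))).symm
  · exact (nonCrossing_of_lt hp (-A) (-B) (-C) (by linarith) (by linarith) (by linarith)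
      (by linarith) (Or.inr (by linarith))).symm

/-- The grid as a finite set. -/
noncomputable def gridFinset (n : ℕ) : Finset (ℤ × ℤ) := Finset.Icc 1 (n : ℤ) ×ˢ Finset.Icc 1 (n : ℤ)

lemma mem_gridFinset {n : ℕ} {p : ℤ × ℤ} :
    p ∈ gridFinset n ↔ 1 ≤ p.1 ∧ p.1 ≤ (n : ℤ) ∧ 1 ≤ p.2 ∧ p.2 ≤ (n : ℤ) := by
  simp [gridFinset, and_assoc]

lemma card_gridFinset (n : ℕ) : (gridFinset n).card = n ^ 2 := by
  simp [gridFinset, sq]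

lemma bddAbove_polyWeight (n : ℕ) :
    BddAbove {w : ℕ | ∃ f, IsSimpleClosedGridPolygon n f ∧ polyWeight n f = w} := by
  refine ⟨n ^ 2 * (n ^ 2 + n ^ 2), ?_⟩
  rintro w ⟨f, hf, rfl⟩
  have hmem : ∀ i, f i ∈ gridSet n := fun i => hf.range_eq ▸ Set.mem_range_self i
  unfold polyWeight
  refine (Finset.sum_le_card_nsmul _ _ (n ^ 2 + n ^ 2) ?_).trans (by simp)
  intro i _
  have h1 := hmem i
  have h2 := hmem (i + 1)
  simp only [gridSet, Set.mem_ofPred_eq] at h1 h2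
  unfold sqLen
  gcongr <;> omega

/-- A self-map of the grid for which every point of the grid lies on the orbit of one point yields
a closed grid polygon; it is simple as soon as its edges pairwise do not cross. -/
lemma le_polyA_of_orbit {n : ℕ} (hn : 2 ≤ n) (g : ℤ × ℤ → ℤ × ℤ) (s : ℤ × ℤ)
    (hs : s ∈ gridFinset n) (hg : ∀ p ∈ gridFinset n, g p ∈ gridFinset n)
    (horb : ∀ p ∈ gridFinset n, ∃ i, g^[i] s = p)
    (hlast : ∃ p ∈ gridFinset n, g p = s)
    (hnc : ∀ p ∈ gridFinset n, ∀ q ∈ gridFinset n, p ≠ q → NonCrossing p (g p) q (g q)) :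
    ∑ p ∈ gridFinset n, sqLen p (g p) ≤ polyA n := by
  have hper : s ∈ Function.periodicPts g := by
    obtain ⟨p, hp, hps⟩ := hlast
    obtain ⟨i, hi⟩ := horb p hp
    refine Function.mk_mem_periodicPts (Nat.succ_pos i) ?_
    rw [Function.IsPeriodicPt, Function.IsFixedPt, Function.iterate_succ_apply', hi, hps]
  have hit : ∀ i, g^[i] s ∈ gridFinset n := by
    intro i
    induction i with
    | zero => exact hs
    | succ i ih => rw [Function.iterate_succ_apply']; exact hg _ ih
  have hpos := Function.minimalPeriod_pos_of_mem_periodicPts hper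
  have hinj : Set.InjOn (fun i => g^[i] s) (Finset.range (Function.minimalPeriod g s)) := by
    intro i hi j hj hij
    exact Function.iterate_injOn_Iio_minimalPeriod (by simpa using hi) (by simpa using hj) hij
  have himage : (Finset.range (Function.minimalPeriod g s)).image (fun i => g^[i] s) =
      gridFinset n := by
    ext p
    simp only [Finset.mem_image, Finset.mem_range]
    constructor
    · rintro ⟨i, _, rfl⟩
      exact hit i
    · intro hp
      obtain ⟨i, rfl⟩ := horb p hp
      exact ⟨i % Function.minimalPeriod g s, Nat.mod_lt _ hpos,
        Function.iterate_mod_minimalPeriod_eq⟩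
  have hP : Function.minimalPeriod g s = n ^ 2 := by
    rw [← card_gridFinset, ← himage, Finset.card_image_of_injOn hinj, Finset.card_range]
  rw [hP] at hinj himage
  have : NeZero (n ^ 2) := ⟨by positivity⟩
  have : Fact (1 < n ^ 2) := ⟨by nlinarith⟩
  have hmod : ∀ i, g^[i % n ^ 2] s = g^[i] s := by
    intro i
    rw [← hP]
    exact Function.iterate_mod_minimalPeriod_eq
  let f : ZMod (n ^ 2) → ℤ × ℤ := fun i => g^[i.val] s
  have hf1 : ∀ i, f (i + 1) = g (f i) := by
    intro i
    change g^[(i + 1).val] s = g (g^[i.val] s)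
    rw [ZMod.val_add, hmod, ZMod.val_one, Function.iterate_succ_apply']
  have hfinj : Function.Injective f := by
    intro i j hij
    apply ZMod.val_injective
    exact hinj (by simpa using ZMod.val_lt i) (by simpa using ZMod.val_lt j) hij
  refine le_csSup (bddAbove_polyWeight n) ⟨f, ⟨hfinj, ?_, ?_⟩, ?_⟩
  · ext p
    have : p ∈ gridSet n ↔ p ∈ gridFinset n := by rw [mem_gridFinset]; rfl
    rw [this]
    constructor
    · rintro ⟨i, rfl⟩
      exact hit _
    · intro hp
      obtain ⟨i, rfl⟩ := horb p hp
      exact ⟨(i : ZMod (n ^ 2)), by change g^[_] s = _; rw [ZMod.val_natCast, hmod]⟩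
  · intro i j hij
    rw [hf1, hf1]
    exact hnc _ (hit _) _ (hit _) (fun h => hij (hfinj h))
  · rw [← himage, Finset.sum_image hinj]
    refine Finset.sum_congr rfl fun i hi => ?_
    rw [hf1]
    change sqLen (g^[_] s) (g (g^[_] s)) = _
    rw [ZMod.val_natCast, hmod]

/-- The length of the longer of the antidiagonals `x + y = u` and `x + y = u + 1` of the box
`[1, n - 1] × [2, n]`. -/
def diagLen (n u : ℤ) : ℤ := min (u - 1) (2 * n - u)

/-- The number of long edges leading from the antidiagonal `x + y = u` to the next one. -/
def numLong (n u : ℤ) : ℤ := (diagLen n u + 2) / 3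

/-- The horizontal extent of the long edges leading from the antidiagonal `x + y = u` to the next
one. Next to the two corners it is adjusted, since the points `(2, 2)` and `(n - 1, n - 1)` are not
visited by the zigzag. -/
def shift (n u : ℤ) : ℤ :=
  if u = 3 then 0 else if u = 2 * n - 3 then 1 else diagLen n u - numLong n u

/-- The least abscissa on the antidiagonal `x + y = u` of the box `[1, n - 1] × [2, n]`. -/
def diagLo (n u : ℤ) : ℤ := max 1 (u - n)

/-- The greatest abscissa on the antidiagonal `x + y = u` of the box `[1, n - 1] × [2, n]`. -/
def diagHi (n u : ℤ) : ℤ := min (n - 1) (u - 2)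

/-- The zigzag part of the successor map: it runs through the antidiagonals of the box
`[1, n - 1] × [2, n]` one after another. -/
def zigzagNext (n : ℤ) (p : ℤ × ℤ) : ℤ × ℤ :=
  if p.1 < diagLo n (p.1 + p.2) + numLong n (p.1 + p.2) then
    (p.1 + shift n (p.1 + p.2), p.2 + 1 - shift n (p.1 + p.2))
  else if diagHi n (p.1 + p.2) - numLong n (p.1 + p.2 - 1) + 1 < p.1 then
    (p.1 - shift n (p.1 + p.2 - 1) - 1, p.2 + shift n (p.1 + p.2 - 1))
  else (p.1 - 1, p.2 + 1)

/-- The successor map of the polygon: a zigzag through the antidiagonals of the box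
`[1, n - 1] × [2, n]`, closed up along the right column and the bottom row, where the points
`(n - 1, n - 1)` and `(2, 2)` are the tips of two long spikes. -/
def nextPt (n : ℤ) (p : ℤ × ℤ) : ℤ × ℤ :=
  if p.2 = 1 then
    if p.1 = 1 then (1, 2) else if p.1 = n then (2, 2) else (p.1 - 1, 1)
  else if p.1 = n then
    if p.2 = 2 then (n - 1, n - 1) else (n, p.2 - 1)
  else if p = (2, 2) then (n - 1, 1)
  else if p = (n - 1, n - 1) then (n, 1)
  else if p = (n - 1, n) then (n, n)
  else zigzagNext n p

/-- Edges of the zigzag. -/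
inductive ZigzagEdge (n : ℤ) : ℤ × ℤ → ℤ × ℤ → Prop
  | up (u a : ℤ) (h1 : 1 ≤ a) (h2 : a ≤ n - 1) (h3 : 2 ≤ u - a) (h4 : a + shift n u ≤ n - 1)
      (h5 : 2 ≤ u + 1 - (a + shift n u)) :
      ZigzagEdge n (a, u - a) (a + shift n u, u + 1 - (a + shift n u))
  | down (u a : ℤ) (h1 : 1 ≤ a) (h2 : a ≤ n - 1) (h3 : 2 ≤ u - a) (h4 : a + shift n u + 1 ≤ n - 1)
      (h5 : 2 ≤ u + 1 - (a + shift n u + 1)) :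
      ZigzagEdge n (a + shift n u + 1, u + 1 - (a + shift n u + 1)) (a, u - a)
  | step (u a : ℤ) (h1 : 2 ≤ a) (h2 : a ≤ n - 1) (h3 : 2 ≤ u - a) :
      ZigzagEdge n (a, u - a) (a - 1, u - (a - 1))

/-- Edges along the right column. -/
inductive RightEdge (n : ℤ) : ℤ × ℤ → ℤ × ℤ → Prop
  | corner : RightEdge n (n - 1, n) (n, n)
  | column (y : ℤ) (h1 : 3 ≤ y) (h2 : y ≤ n) : RightEdge n (n, y) (n, y - 1)
  | toTip : RightEdge n (n, 2) (n - 1, n - 1)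
  | fromTip : RightEdge n (n - 1, n - 1) (n, 1)

/-- Edges along the bottom row. -/
inductive BottomEdge (n : ℤ) : ℤ × ℤ → ℤ × ℤ → Prop
  | toTip : BottomEdge n (n, 1) (2, 2)
  | fromTip : BottomEdge n (2, 2) (n - 1, 1)
  | row (x : ℤ) (h1 : 2 ≤ x) (h2 : x ≤ n - 1) : BottomEdge n (x, 1) (x - 1, 1)
  | corner : BottomEdge n (1, 1) (1, 2)

lemma zigzagEdge_zigzagNext {n x y : ℤ} (hn : 6 ≤ n) (hx1 : 1 ≤ x) (hx2 : x ≤ n - 1)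
    (hy1 : 2 ≤ y) (hy2 : y ≤ n) (h1 : (x, y) ≠ (2, 2)) (h2 : (x, y) ≠ (n - 1, n - 1))
    (h3 : (x, y) ≠ (n - 1, n)) : ZigzagEdge n (x, y) (zigzagNext n (x, y)) := by
  obtain ⟨u, rfl⟩ : ∃ u, y = u - x := ⟨x + y, by ring⟩
  simp only [ne_eq, Prod.mk.injEq] at h1 h2 h3
  unfold zigzagNext
  simp only [add_sub_cancel]
  split_ifs with hL hR
  · have := ZigzagEdge.up (n := n) u x hx1 hx2 hy1 ?_ ?_
    · convert this using 2
      ring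
    · unfold shift diagLo numLong diagLen at *
      split_ifs <;> omega
    · unfold shift diagLo numLong diagLen at *
      split_ifs <;> omega
  · have := ZigzagEdge.down (n := n) (u - 1) (x - shift n (u - 1) - 1) ?_ ?_ ?_ ?_ ?_
    · convert this using 2 <;> ring
    all_goals
      unfold shift diagLo diagHi numLong diagLen at *
      split_ifs <;> omega
  · have := ZigzagEdge.step (n := n) u x ?_ hx2 hy1
    · convert this using 2
      ring
    · unfold diagLo diagHi numLong diagLen at *
      omega

lemma edge_nextPt {n x y : ℤ} (hn : 6 ≤ n) (hx1 : 1 ≤ x) (hx2 : x ≤ n) (hy1 : 1 ≤ y) (hy2 : y ≤ n) :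
    ZigzagEdge n (x, y) (nextPt n (x, y)) ∨ RightEdge n (x, y) (nextPt n (x, y)) ∨
      BottomEdge n (x, y) (nextPt n (x, y)) := by
  unfold nextPt
  simp only
  split_ifs with h1 h2 h3 h4 h5 h6 h7 h8
  · subst h1 h2; exact Or.inr (Or.inr .corner)
  · subst h1 h3; exact Or.inr (Or.inr .toTip)
  · subst h1; exact Or.inr (Or.inr (.row x (by omega) (by omega)))
  · subst h4 h5; exact Or.inr (Or.inl .toTip)
  · subst h4; exact Or.inr (Or.inl (.column y (by omega) (by omega)))
  · rw [h6]; exact Or.inr (Or.inr .fromTip)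
  · rw [h7]; exact Or.inr (Or.inl .fromTip)
  · rw [h8]; exact Or.inr (Or.inl .corner)
  · exact Or.inl (zigzagEdge_zigzagNext hn hx1 (by omega) (by omega) hy2 h6 h7 h8)

lemma ZigzagEdge.prim {n : ℤ} {p q : ℤ × ℤ} (h : ZigzagEdge n p q) : Prim p q := by
  cases h with
  | up => exact ⟨1, 1, by ring⟩
  | down => exact ⟨-1, -1, by ring⟩
  | step => exact ⟨-1, 0, by ring⟩

lemma RightEdge.prim {n : ℤ} {p q : ℤ × ℤ} (h : RightEdge n p q) : Prim p q := by
  cases h with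
  | corner => exact ⟨1, 0, by ring⟩
  | column => exact ⟨0, -1, by ring⟩
  | toTip => exact ⟨-1, 0, by ring⟩
  | fromTip => exact ⟨1, 0, by ring⟩

lemma BottomEdge.prim {n : ℤ} {p q : ℤ × ℤ} (h : BottomEdge n p q) : Prim p q := by
  cases h with
  | toTip => exact ⟨0, 1, by ring⟩
  | fromTip => exact ⟨0, -1, by ring⟩
  | row => exact ⟨-1, 0, by ring⟩
  | corner => exact ⟨0, 1, by ring⟩

lemma NonCrossing.swap_left {p p' q q' : ℤ × ℤ} (h : NonCrossing p p' q q') :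
    NonCrossing p' p q q' := by
  unfold NonCrossing at *
  rwa [segment_symm, Set.pair_comm (toR2 p')]

/-- Two edges between consecutive antidiagonals do not cross if they join different pairs of
antidiagonals or are comparable. -/
lemma nonCrossing_strip {u u' a b a' b' : ℤ}
    (h : u = u' → (a ≤ a' ∧ b ≤ b' ∧ (a < a' ∨ b < b')) ∨ (a' ≤ a ∧ b' ≤ b ∧ (a' < a ∨ b' < b))) :
    NonCrossing (a, u - a) (b, u + 1 - b) (a', u' - a') (b', u' + 1 - b') := by
  have hp : Prim (a, u - a) (b, u + 1 - b) := ⟨1, 1, by ring⟩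
  have hq : Prim (a', u' - a') (b', u' + 1 - b') := ⟨1, 1, by ring⟩
  rcases lt_trichotomy u u' with hu | rfl | hu
  · apply nonCrossing_of_separated hp hq 1 1 u' <;> simp only <;> omega
  · rcases h rfl with ⟨h1, h2, h3⟩ | ⟨h1, h2, h3⟩
    · apply nonCrossing_of_separated hp hq (1 - (b - a)) (-(b - a)) (a - (b - a) * u)
      · linarith
      · linarith
      · linarith
      · linarith
      · rcases h3 with h3 | h3
        · exact Or.inr (Or.inr (Or.inl (by linarith)))
        · exact Or.inr (Or.inr (Or.inr (by linarith)))
    · refine NonCrossing.symm ?_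
      apply nonCrossing_of_separated hq hp (1 - (b' - a')) (-(b' - a')) (a' - (b' - a') * u)
      · linarith
      · linarith
      · linarith
      · linarith
      · rcases h3 with h3 | h3
        · exact Or.inr (Or.inr (Or.inl (by linarith)))
        · exact Or.inr (Or.inr (Or.inr (by linarith)))
  · refine NonCrossing.symm ?_
    apply nonCrossing_of_separated hq hp 1 1 u <;> simp only <;> omega

lemma nonCrossing_strip_step (u a b v x : ℤ) :
    NonCrossing (a, u - a) (b, u + 1 - b) (x, v - x) (x - 1, v - (x - 1)) := by
  have hp : Prim (a, u - a) (b, u + 1 - b) := ⟨1, 1, by ring⟩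
  have hq : Prim (x, v - x) (x - 1, v - (x - 1)) := ⟨-1, 0, by ring⟩
  rcases lt_or_ge u v with hu | hu
  · apply nonCrossing_of_separated hp hq 1 1 v <;> simp only <;> omega
  · refine NonCrossing.symm ?_
    apply nonCrossing_of_separated hq hp 1 1 u <;> simp only <;> omega

lemma nonCrossing_step_step {u x v y : ℤ} (h : u = v → x ≠ y) :
    NonCrossing (x, u - x) (x - 1, u - (x - 1)) (y, v - y) (y - 1, v - (y - 1)) := by
  have hp : Prim (x, u - x) (x - 1, u - (x - 1)) := ⟨-1, 0, by ring⟩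
  have hq : Prim (y, v - y) (y - 1, v - (y - 1)) := ⟨-1, 0, by ring⟩
  rcases lt_trichotomy u v with hu | rfl | hu
  · apply nonCrossing_of_separated hp hq 1 1 v <;> simp only <;> omega
  · rcases lt_or_gt_of_ne (h rfl) with h | h
    · apply nonCrossing_of_separated hp hq 1 0 x <;> simp only <;> omega
    · refine NonCrossing.symm ?_
      apply nonCrossing_of_separated hq hp 1 0 y <;> simp only <;> omega
  · refine NonCrossing.symm ?_
    apply nonCrossing_of_separated hq hp 1 1 u <;> simp only <;> omega

lemma ZigzagEdge.nonCrossing {n : ℤ} {p p' q q' : ℤ × ℤ} (h : ZigzagEdge n p p')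
    (h' : ZigzagEdge n q q') (hne : p ≠ q) : NonCrossing p p' q q' := by
  cases h with
  | up u a =>
    cases h' with
    | up v b =>
      refine nonCrossing_strip ?_
      rintro rfl
      have : a ≠ b := by rintro rfl; exact hne rfl
      omega
    | down v b =>
      refine (NonCrossing.swap_left (nonCrossing_strip ?_).symm).symm
      rintro rfl
      omega
    | step v b => exact nonCrossing_strip_step _ _ _ _ _
  | down u a =>
    refine NonCrossing.swap_left ?_
    cases h' with
    | up v b =>
      refine nonCrossing_strip ?_
      rintro rfl
      omega
    | down v b =>
      refine (NonCrossing.swap_left (nonCrossing_strip ?_).symm).symm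
      rintro rfl
      have : a ≠ b := by rintro rfl; exact hne rfl
      omega
    | step v b => exact nonCrossing_strip_step _ _ _ _ _
  | step u a =>
    cases h' with
    | up v b => exact (nonCrossing_strip_step _ _ _ _ _).symm
    | down v b => exact (NonCrossing.swap_left (nonCrossing_strip_step _ _ _ _ _)).symm
    | step v b =>
      refine nonCrossing_step_step ?_
      rintro rfl rfl
      exact hne rfl

lemma ZigzagEdge.nonCrossing_right {n : ℤ} {p p' q q' : ℤ × ℤ} (h : ZigzagEdge n p p')
    (h' : RightEdge n q q') : NonCrossing p p' q q' := by
  apply nonCrossing_of_separated h.prim h'.prim 1 0 (n - 1) <;>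
    cases h <;> cases h' <;> simp only <;> omega

lemma ZigzagEdge.nonCrossing_bottom {n : ℤ} {p p' q q' : ℤ × ℤ} (h : ZigzagEdge n p p')
    (h' : BottomEdge n q q') : NonCrossing p p' q q' := by
  apply nonCrossing_of_separated h.prim h'.prim 0 (-1) (-2) <;>
    cases h <;> cases h' <;> simp only <;> omega

lemma RightEdge.nonCrossing_bottom {n : ℤ} (hn : 6 ≤ n) {p p' q q' : ℤ × ℤ}
    (h : RightEdge n p p') (h' : BottomEdge n q q') : NonCrossing p p' q q' := by
  have hp := h.prim
  have hq := h'.prim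
  cases h with
  | fromTip =>
    cases h' with
    | toTip => apply nonCrossing_of_separated hp hq (-1) (-1) (-(n + 1)) <;> simp only <;> omega
    | fromTip => apply nonCrossing_of_separated hp hq (-1) 0 (-(n - 1)) <;> simp only <;> omega
    | row => apply nonCrossing_of_separated hp hq (-1) 0 (-(n - 1)) <;> simp only <;> omega
    | corner => apply nonCrossing_of_separated hp hq (-1) 0 (-(n - 1)) <;> simp only <;> omega
  | _ => apply nonCrossing_of_separated hp hq 0 (-1) (-2) <;> cases h' <;> simp only <;> omega

lemma RightEdge.nonCrossing {n : ℤ} (hn : 6 ≤ n) {p p' q q' : ℤ × ℤ} (h : RightEdge n p p')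
    (h' : RightEdge n q q') (hne : p ≠ q) : NonCrossing p p' q q' := by
  have hp := h.prim
  have hq := h'.prim
  have hcol : ∀ {y z : ℤ}, y < z → NonCrossing (n, y) (n, y - 1) (n, z) (n, z - 1) := by
    intro y z hyz
    apply nonCrossing_of_separated ⟨0, -1, by ring⟩ ⟨0, -1, by ring⟩ 0 1 y <;> simp only <;> omega
  have htip : NonCrossing (n - 1, n - 1) (n, 1) (n, 2) (n - 1, n - 1) := by
    apply nonCrossing_of_separated ⟨1, 0, by ring⟩ ⟨-1, 0, by ring⟩ (n - 3) 1 ((n - 3) * n + 2)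
    · linarith
    · linarith
    · linarith
    · linarith
    · exact Or.inr (Or.inl (by linarith))
  cases h with
  | corner =>
    cases h' with
    | corner => exact absurd rfl hne
    | _ => apply nonCrossing_of_separated hp hq 0 (-1) (-n) <;> simp only <;> omega
  | column y =>
    cases h' with
    | corner => apply nonCrossing_of_separated hp hq 0 1 n <;> simp only <;> omega
    | column z =>
      have : y ≠ z := by rintro rfl; exact hne rfl
      rcases lt_or_gt_of_ne this with h | h
      · exact hcol h
      · exact (hcol h).symm
    | _ => apply nonCrossing_of_separated hp hq (-1) 0 (-n) <;> simp only <;> omega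
  | toTip =>
    cases h' with
    | corner => apply nonCrossing_of_separated hp hq 0 1 n <;> simp only <;> omega
    | column => apply nonCrossing_of_separated hp hq 1 0 n <;> simp only <;> omega
    | toTip => exact absurd rfl hne
    | fromTip => exact htip.symm
  | fromTip =>
    cases h' with
    | corner => apply nonCrossing_of_separated hp hq 0 1 n <;> simp only <;> omega
    | column => apply nonCrossing_of_separated hp hq 1 0 n <;> simp only <;> omega
    | toTip => exact htip
    | fromTip => exact absurd rfl hne

lemma BottomEdge.nonCrossing {n : ℤ} (hn : 6 ≤ n) {p p' q q' : ℤ × ℤ} (h : BottomEdge n p p')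
    (h' : BottomEdge n q q') (hne : p ≠ q) : NonCrossing p p' q q' := by
  have hp := h.prim
  have hq := h'.prim
  have hrow : ∀ {y z : ℤ}, y < z → NonCrossing (y, 1) (y - 1, 1) (z, 1) (z - 1, 1) := by
    intro y z hyz
    apply nonCrossing_of_separated ⟨-1, 0, by ring⟩ ⟨-1, 0, by ring⟩ 1 0 y <;> simp only <;> omega
  have htip : NonCrossing (2, 2) (n - 1, 1) (n, 1) (2, 2) := by
    apply nonCrossing_of_separated ⟨0, -1, by ring⟩ ⟨0, 1, by ring⟩ 1 (n - 3) (2 * n - 4)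
    · linarith
    · linarith
    · linarith
    · linarith
    · exact Or.inr (Or.inr (Or.inl (by linarith)))
  cases h with
  | corner =>
    cases h' with
    | corner => exact absurd rfl hne
    | _ => apply nonCrossing_of_separated hp hq 1 0 1 <;> simp only <;> omega
  | row y =>
    cases h' with
    | corner => apply nonCrossing_of_separated hp hq (-1) 0 (-1) <;> simp only <;> omega
    | row z =>
      have : y ≠ z := by rintro rfl; exact hne rfl
      rcases lt_or_gt_of_ne this with h | h
      · exact hrow h
      · exact (hrow h).symm
    | _ => apply nonCrossing_of_separated hp hq 0 1 1 <;> simp only <;> omega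
  | toTip =>
    cases h' with
    | corner => apply nonCrossing_of_separated hp hq (-1) 0 (-1) <;> simp only <;> omega
    | row => apply nonCrossing_of_separated hp hq 0 (-1) (-1) <;> simp only <;> omega
    | toTip => exact absurd rfl hne
    | fromTip => exact htip.symm
  | fromTip =>
    cases h' with
    | corner => apply nonCrossing_of_separated hp hq (-1) 0 (-1) <;> simp only <;> omega
    | row => apply nonCrossing_of_separated hp hq 0 (-1) (-1) <;> simp only <;> omega
    | toTip => exact htip
    | fromTip => exact absurd rfl hne

lemma nonCrossing_nextPt {n : ℕ} (hn : 6 ≤ n) {p q : ℤ × ℤ} (hp : p ∈ gridFinset n)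
    (hq : q ∈ gridFinset n) (hne : p ≠ q) :
    NonCrossing p (nextPt n p) q (nextPt n q) := by
  have hn' : (6 : ℤ) ≤ n := by exact_mod_cast hn
  rw [mem_gridFinset] at hp hq
  rcases edge_nextPt hn' hp.1 hp.2.1 hp.2.2.1 hp.2.2.2 with h | h | h <;>
    rcases edge_nextPt hn' hq.1 hq.2.1 hq.2.2.1 hq.2.2.2 with h' | h' | h'
  · exact h.nonCrossing h' hne
  · exact h.nonCrossing_right h'
  · exact h.nonCrossing_bottom h'
  · exact (h'.nonCrossing_right h).symm
  · exact h.nonCrossing hn' h' hne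
  · exact h.nonCrossing_bottom hn' h'
  · exact (h'.nonCrossing_bottom h).symm
  · exact (h'.nonCrossing_bottom hn' h).symm
  · exact h.nonCrossing hn' h' hne

lemma nextPt_eq_zigzagNext {n x u : ℤ} (hx : x ≤ n - 1) (hy : 2 ≤ u - x)
    (h1 : x = 2 → u ≠ 4) (h2 : x = n - 1 → u ≠ 2 * n - 2 ∧ u ≠ 2 * n - 1) :
    nextPt n (x, u - x) = zigzagNext n (x, u - x) := by
  unfold nextPt
  simp only [Prod.mk.injEq]
  rw [if_neg (by omega), if_neg (by omega), if_neg (by omega), if_neg (by omega),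
    if_neg (by omega)]

lemma nextPt_mem_gridFinset {n : ℕ} (hn : 6 ≤ n) {p : ℤ × ℤ} (hp : p ∈ gridFinset n) :
    nextPt n p ∈ gridFinset n := by
  obtain ⟨x, y⟩ := p
  rw [mem_gridFinset] at *
  simp only at hp
  unfold nextPt
  simp only [Prod.mk.injEq]
  split_ifs
  all_goals try omega
  unfold zigzagNext shift diagLo diagHi numLong diagLen
  split_ifs <;> simp only <;> omega

lemma nextPt_up {n u x : ℤ} (hn : 6 ≤ n) (hu : 3 ≤ u) (hu' : u ≤ 2 * n - 2)
    (hx1 : diagLo n u ≤ x) (hx2 : x < diagLo n u + numLong n u) :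
    nextPt n (x, u - x) = (x + shift n u, u + 1 - (x + shift n u)) := by
  rw [nextPt_eq_zigzagNext]
  · unfold zigzagNext
    simp only [add_sub_cancel]
    rw [if_pos hx2]
    ext <;> simp only <;> ring
  all_goals
    unfold diagLo numLong diagLen at *
    omega

lemma nextPt_down {n u x : ℤ} (hn : 6 ≤ n) (hu : 4 ≤ u) (hu' : u ≤ 2 * n - 4)
    (hx1 : diagLo n u < x) (hx2 : x < diagLo n u + numLong n u) :
    nextPt n (x + shift n u, u + 1 - (x + shift n u)) = (x - 1, u - (x - 1)) := by
  rw [nextPt_eq_zigzagNext]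
  · unfold zigzagNext
    simp only [add_sub_cancel, add_sub_cancel_right]
    rw [if_neg, if_pos]
    · ext <;> simp only <;> ring
    all_goals
      unfold shift diagLo numLong diagLen at *
      try unfold diagHi
      rw [if_neg (by omega), if_neg (by omega)]
      omega
  all_goals
    unfold shift diagLo numLong diagLen at *
    rw [if_neg (by omega), if_neg (by omega)]
    omega

lemma nextPt_step {n u x : ℤ} (hn : 6 ≤ n) (hu : 5 ≤ u) (hu' : u ≤ 2 * n - 3)
    (hx1 : diagLo n u + numLong n u ≤ x) (hx2 : x ≤ diagHi n u - numLong n (u - 1) + 1) :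
    nextPt n (x, u - x) = (x - 1, u - (x - 1)) := by
  rw [nextPt_eq_zigzagNext]
  · unfold zigzagNext
    simp only [add_sub_cancel]
    rw [if_neg (by omega), if_neg (by omega)]
    ext <;> simp only <;> ring
  all_goals
    unfold diagLo diagHi numLong diagLen at *
    omega

/-- The points on the orbit of `(1, 2)` under the successor map. -/
def Reach (n : ℤ) (p : ℤ × ℤ) : Prop := ∃ i, (nextPt n)^[i] (1, 2) = p

lemma Reach.of_nextPt {n : ℤ} {p q : ℤ × ℤ} (h : Reach n p) (hq : nextPt n p = q) :
    Reach n q := by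
  obtain ⟨i, hi⟩ := h
  exact ⟨i + 1, by rw [Function.iterate_succ_apply', hi, hq]⟩

/-- From the first long edge between two antidiagonals one reaches the sources of all long edges
between them. -/
lemma reach_of_lt {n u x : ℤ} (hn : 6 ≤ n) (hu : 4 ≤ u) (hu' : u ≤ 2 * n - 4)
    (h : Reach n (diagLo n u + numLong n u - 1, u - (diagLo n u + numLong n u - 1)))
    (hx1 : diagLo n u ≤ x) (hx2 : x < diagLo n u + numLong n u) : Reach n (x, u - x) := by
  obtain ⟨k, rfl⟩ : ∃ k : ℕ, x = diagLo n u + numLong n u - 1 - k :=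
    ⟨(diagLo n u + numLong n u - 1 - x).toNat, by omega⟩
  clear hx2
  induction k with
  | zero => simpa using h
  | succ k ih =>
    have h1 := ih (by push_cast at hx1; omega)
    have h2 := h1.of_nextPt (nextPt_up hn (by omega) (by omega) (by push_cast at hx1; omega)
      (by omega))
    have h3 := h2.of_nextPt (nextPt_down hn hu hu' (by push_cast at hx1; omega) (by omega))
    convert h3 using 2 <;> push_cast <;> ring

/-- From the first long edge between two antidiagonals one reaches the rest of the second one up to
the start of its long edges. -/
lemma reach_of_le {n u x : ℤ} (hn : 6 ≤ n) (hu : 4 ≤ u) (hu' : u ≤ 2 * n - 4)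
    (h : Reach n (diagLo n u + numLong n u - 1, u - (diagLo n u + numLong n u - 1)))
    (hx1 : diagLo n (u + 1) + numLong n (u + 1) - 1 ≤ x) (hx2 : x ≤ diagHi n (u + 1)) :
    Reach n (x, u + 1 - x) := by
  have hR : ∀ y, diagHi n (u + 1) - numLong n u + 1 ≤ y → y ≤ diagHi n (u + 1) →
      Reach n (y, u + 1 - y) := by
    intro y hy1 hy2
    have hs : shift n u = diagHi n (u + 1) - numLong n u + 1 - diagLo n u ∨
        (u = 2 * n - 3) := by
      unfold shift diagLo diagHi numLong diagLen
      split_ifs <;> omega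
    have h1 := reach_of_lt (x := y - shift n u) hn hu hu' h (by omega) (by omega)
    have h2 := h1.of_nextPt (nextPt_up hn (by omega) (by omega) (by omega) (by omega))
    convert h2 using 2 <;> ring
  rcases le_or_gt (diagHi n (u + 1) - numLong n u + 1) x with hx | hx
  · exact hR x hx hx2
  clear hx2
  obtain ⟨k, rfl⟩ : ∃ k : ℕ, x = diagHi n (u + 1) - numLong n u + 1 - k :=
    ⟨(diagHi n (u + 1) - numLong n u + 1 - x).toNat, by omega⟩
  clear hx
  induction k with
  | zero =>
    simp only [Nat.cast_zero, sub_zero]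
    refine hR _ le_rfl ?_
    unfold numLong diagLen
    omega
  | succ k ih =>
    have h1 := ih (by push_cast at hx1; omega)
    have h2 := h1.of_nextPt (nextPt_step hn (by omega) (by omega) (by push_cast at hx1; omega)
      (by simp only [add_sub_cancel_right]; omega))
    convert h2 using 2 <;> push_cast <;> ring

lemma reach_first {n u : ℤ} (hn : 6 ≤ n) (hu : 4 ≤ u) (hu' : u ≤ 2 * n - 3) :
    Reach n (diagLo n u + numLong n u - 1, u - (diagLo n u + numLong n u - 1)) := by
  induction u, hu using Int.leInduction with
  | base =>
    have h : Reach n (1, 2) := ⟨0, rfl⟩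
    have h1 := h.of_nextPt (q := (1, 3)) (by
      have := nextPt_up (n := n) (u := 3) (x := 1) hn (by omega) (by omega)
        (by unfold diagLo; omega) (by unfold diagLo numLong diagLen; omega)
      have hs : shift n 3 = 0 := if_pos rfl
      simpa [hs] using this)
    have hx : diagLo n 4 + numLong n 4 - 1 = 1 := by unfold diagLo numLong diagLen; omega
    rw [hx]
    exact h1
  | succ u hu ih =>
    refine reach_of_le hn hu (by omega) (ih (by omega)) le_rfl ?_
    unfold diagLo diagHi numLong diagLen
    omega

lemma reach_zigzag {n u x : ℤ} (hn : 6 ≤ n) (hu : 5 ≤ u) (hu' : u ≤ 2 * n - 3)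
    (hx1 : diagLo n u ≤ x) (hx2 : x ≤ diagHi n u) : Reach n (x, u - x) := by
  have h := reach_first hn (by omega : 4 ≤ u) hu'
  rcases lt_or_ge (diagLo n u + numLong n u - 1) x with h1 | h1
  · have := reach_of_le (u := u - 1) (x := x) hn (by omega) (by omega)
      (reach_first hn (by omega) (by omega)) (by rw [sub_add_cancel]; omega)
      (by rw [sub_add_cancel]; omega)
    rwa [sub_add_cancel] at this
  · rcases h1.lt_or_eq with h1 | rfl
    · refine reach_of_lt hn (by omega) ?_ h hx1 (by omega)
      unfold diagLo numLong diagLen at *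
      omega
    · exact h

lemma reach_of_mem {n : ℕ} (hn : 6 ≤ n) {p : ℤ × ℤ} (hp : p ∈ gridFinset n) : Reach n p := by
  obtain ⟨N, hN⟩ : ∃ N : ℤ, N = n := ⟨_, rfl⟩
  have hn' : (6 : ℤ) ≤ N := by omega
  rw [mem_gridFinset, ← hN] at hp
  rw [← hN]
  clear hN hn
  have a1 : Reach N (1, 2) := ⟨0, rfl⟩
  have a2 : Reach N (1, 3) := by
    have := reach_first hn' le_rfl (by omega)
    have hx : diagLo N 4 + numLong N 4 - 1 = 1 := by unfold diagLo numLong diagLen; omega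
    rwa [hx] at this
  have b1 : Reach N (N - 3, N) := by
    have := reach_zigzag (u := 2 * N - 3) (x := N - 3) hn' (by omega) le_rfl
      (by unfold diagLo; omega) (by unfold diagHi; omega)
    convert this using 2
    ring
  have b2 : Reach N (N - 2, N) := by
    refine b1.of_nextPt ?_
    have := nextPt_up (u := 2 * N - 3) (x := N - 3) hn' (by omega) (by omega)
        (by unfold diagLo; omega) (by unfold diagLo numLong diagLen; omega)
    have hs : shift N (2 * N - 3) = 1 := by unfold shift; rw [if_neg (by omega), if_pos rfl]
    rw [hs] at this
    convert this using 2 <;> ring_nf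
  have b3 : Reach N (N - 1, N) := by
    refine b2.of_nextPt ?_
    have := nextPt_up (u := 2 * N - 2) (x := N - 2) hn' (by omega) (by omega)
        (by unfold diagLo; omega) (by unfold diagLo numLong diagLen; omega)
    have hs : shift N (2 * N - 2) = 1 := by
      unfold shift numLong diagLen
      rw [if_neg (by omega), if_neg (by omega)]
      omega
    rw [hs] at this
    convert this using 2 <;> ring_nf
  have c1 : Reach N (N, N) := by
    refine b3.of_nextPt ?_
    unfold nextPt
    simp only [Prod.mk.injEq]
    split_ifs <;> first | rfl | omega
  have c2 : ∀ k : ℕ, 2 ≤ N - k → Reach N (N, N - k) := by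
    intro k
    induction k with
    | zero => intro _; simpa using c1
    | succ k ih =>
      intro hk
      push_cast at hk
      refine (ih (by omega)).of_nextPt ?_
      unfold nextPt
      simp only [Prod.mk.injEq]
      split_ifs <;> first | omega | (push_cast; ring_nf)
  have c3 : ∀ y, 2 ≤ y → y ≤ N → Reach N (N, y) := by
    intro y h1 h2
    have := c2 (N - y).toNat (by omega)
    convert this using 2
    omega
  have c4 : Reach N (N - 1, N - 1) := by
    refine (c3 2 le_rfl (by omega)).of_nextPt ?_
    unfold nextPt
    simp only [Prod.mk.injEq]
    split_ifs <;> first | rfl | omega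
  have c5 : Reach N (N, 1) := by
    refine c4.of_nextPt ?_
    unfold nextPt
    simp only [Prod.mk.injEq]
    split_ifs <;> first | rfl | omega
  have d1 : Reach N (2, 2) := by
    refine c5.of_nextPt ?_
    unfold nextPt
    simp only [Prod.mk.injEq]
    split_ifs <;> first | rfl | omega
  have d2 : Reach N (N - 1, 1) := by
    refine d1.of_nextPt ?_
    unfold nextPt
    simp only [Prod.mk.injEq]
    split_ifs <;> first | rfl | omega
  have d3 : ∀ k : ℕ, 1 ≤ N - 1 - k → Reach N (N - 1 - k, 1) := by
    intro k
    induction k with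
    | zero => intro _; simpa using d2
    | succ k ih =>
      intro hk
      push_cast at hk
      refine (ih (by omega)).of_nextPt ?_
      unfold nextPt
      simp only [Prod.mk.injEq]
      split_ifs <;> first | omega | (push_cast; ring_nf)
  have d4 : ∀ x, 1 ≤ x → x ≤ N - 1 → Reach N (x, 1) := by
    intro x h1 h2
    have := d3 (N - 1 - x).toNat (by omega)
    convert this using 2
    omega
  obtain ⟨x, y⟩ := p
  simp only at hp
  by_cases hy : y = 1
  · subst hy
    by_cases hx : x = N
    · subst hx; exact c5
    · exact d4 x (by omega) (by omega)
  by_cases hx : x = N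
  · subst hx; exact c3 y (by omega) (by omega)
  by_cases h3 : x + y ≤ 4
  · obtain ⟨rfl, rfl⟩ | ⟨rfl, rfl⟩ | ⟨rfl, rfl⟩ :
      (x = 1 ∧ y = 2) ∨ (x = 1 ∧ y = 3) ∨ (x = 2 ∧ y = 2) := by omega
    · exact a1
    · exact a2
    · exact d1
  by_cases h4 : 2 * N - 2 ≤ x + y
  · obtain ⟨rfl, rfl⟩ | ⟨rfl, rfl⟩ | ⟨rfl, rfl⟩ :
      (x = N - 2 ∧ y = N) ∨ (x = N - 1 ∧ y = N) ∨ (x = N - 1 ∧ y = N - 1) := by omega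
    · exact b2
    · exact b3
    · exact c4
  · have := reach_zigzag (u := x + y) (x := x) hn' (by omega) (by omega)
      (by unfold diagLo; omega) (by unfold diagHi; omega)
    rwa [add_sub_cancel_left] at this

/-- The squared length of the edge starting at a point. -/
def edgeWeight (n : ℤ) (p : ℤ × ℤ) : ℤ :=
  ((nextPt n p).1 - p.1) ^ 2 + ((nextPt n p).2 - p.2) ^ 2

lemma cast_sqLen_nextPt (n : ℤ) (p : ℤ × ℤ) : (sqLen p (nextPt n p) : ℤ) = edgeWeight n p := by
  simp [sqLen, edgeWeight]

/-- The excess over `2` of the squared length of the edge of the zigzag starting at the point with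
abscissa `x` on the antidiagonal `x + y = u`. -/
def excess (n u x : ℤ) : ℤ :=
  if x < diagLo n u + numLong n u then shift n u ^ 2 + (1 - shift n u) ^ 2 - 2
  else if diagHi n u - numLong n (u - 1) + 1 < x then
    (shift n (u - 1) + 1) ^ 2 + shift n (u - 1) ^ 2 - 2
  else 0

lemma edgeWeight_box {n x y : ℤ} (hn : 6 ≤ n) (hx1 : 1 ≤ x) (hx2 : x ≤ n - 1) (hy1 : 2 ≤ y) :
    edgeWeight n (x, y) = excess n (x + y) x + 2 +
      (if (x, y) = (2, 2) then (n - 3) ^ 2 - 1 else 0) +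
      (if (x, y) = (n - 1, n - 1) then (n - 2) ^ 2 - 1 else 0) := by
  unfold edgeWeight nextPt
  rw [if_neg (by simp only; omega), if_neg (by simp only; omega)]
  split_ifs with h1 h2 h3 h4
  · simp only [Prod.mk.injEq] at h1 h2
    omega
  · simp only [Prod.mk.injEq] at h1
    obtain ⟨rfl, rfl⟩ := h1
    have : excess n (2 + 2) 2 = 0 := by
      unfold excess
      rw [if_neg, if_neg]
      all_goals
        simp only [diagLo, diagHi, numLong, diagLen]
        omega
    rw [this]
    simp only
    ring
  · simp only [Prod.mk.injEq] at h3
    obtain ⟨rfl, rfl⟩ := h3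
    have : excess n (n - 1 + (n - 1)) (n - 1) = 0 := by
      unfold excess
      rw [if_neg, if_neg]
      all_goals
        simp only [diagLo, diagHi, numLong, diagLen]
        omega
    rw [this]
    simp only
    ring
  · simp only [Prod.mk.injEq] at h4
    obtain ⟨rfl, rfl⟩ := h4
    have hs : shift y (y - 1 + y) = 0 := by
      unfold shift numLong diagLen
      split_ifs <;> omega
    unfold excess
    rw [if_pos, hs]
    · simp only
      ring
    · unfold diagLo numLong diagLen
      omega
  · unfold zigzagNext excess
    split_ifs <;> simp only <;> ring

lemma edgeWeight_right {n y : ℤ} (hn : 6 ≤ n) :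
    edgeWeight n (n, y) =
      1 + (if y = 1 then (n - 2) ^ 2 else 0) + (if y = 2 then (n - 3) ^ 2 else 0) := by
  unfold edgeWeight nextPt
  simp only
  split_ifs <;> first | omega | (subst_vars; ring)

lemma edgeWeight_bottom {n x : ℤ} (hx2 : x ≤ n - 1) :
    edgeWeight n (x, 1) = 1 := by
  unfold edgeWeight nextPt
  simp only
  split_ifs <;> first | omega | (subst_vars; ring)

/-- Summation over the box `[1, n - 1] × [2, n]` along antidiagonals. -/
lemma sum_box (n : ℤ) (g : ℤ → ℤ → ℤ) :
    ∑ x ∈ Finset.Icc 1 (n - 1), ∑ y ∈ Finset.Icc 2 n, g (x + y) x =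
      ∑ u ∈ Finset.Icc 3 (2 * n - 1), ∑ x ∈ Finset.Icc (diagLo n u) (diagHi n u), g u x := by
  rw [Finset.sum_sigma', Finset.sum_sigma']
  refine Finset.sum_nbij' (fun p => ⟨p.1 + p.2, p.1⟩) (fun p => ⟨p.2, p.1 - p.2⟩) ?_ ?_ ?_ ?_ ?_
  · rintro ⟨x, y⟩ h
    simp only [Finset.mem_sigma, Finset.mem_Icc, diagLo, diagHi] at *
    omega
  · rintro ⟨x, y⟩ h
    simp only [Finset.mem_sigma, Finset.mem_Icc, diagLo, diagHi] at *
    omega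
  · rintro ⟨x, y⟩ h
    simp
  · rintro ⟨x, y⟩ h
    simp
  · rintro ⟨x, y⟩ h
    rfl

lemma sum_Icc_eq_sum_range (a : ℤ) (N : ℕ) (g : ℤ → ℤ) :
    ∑ u ∈ Finset.Icc a (a + N - 1), g u = ∑ i ∈ Finset.range N, g (a + i) := by
  refine Finset.sum_nbij' (fun u => (u - a).toNat) (fun i => a + i) ?_ ?_ ?_ ?_ ?_
  · intro u hu
    simp only [Finset.mem_Icc, Finset.mem_range] at *
    omega
  · intro u hu
    simp only [Finset.mem_Icc, Finset.mem_range] at *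
    omega
  · intro u hu
    simp only [Finset.mem_Icc] at *
    omega
  · intro u hu
    simp
  · intro u hu
    simp only [Finset.mem_Icc] at *
    congr 1
    omega

lemma sum_excess {n u : ℤ} (hu : 3 ≤ u) (hu' : u ≤ 2 * n - 1) :
    ∑ x ∈ Finset.Icc (diagLo n u) (diagHi n u), excess n u x =
      numLong n u * (shift n u ^ 2 + (1 - shift n u) ^ 2 - 2) +
        (numLong n (u - 1) - 1) * ((shift n (u - 1) + 1) ^ 2 + shift n (u - 1) ^ 2 - 2) := by
  unfold excess
  rw [Finset.sum_ite, Finset.sum_ite, Finset.sum_const, Finset.sum_const, Finset.sum_const_zero,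
    add_zero, nsmul_eq_mul, nsmul_eq_mul, Finset.filter_filter]
  have h1 : (Finset.Icc (diagLo n u) (diagHi n u)).filter (· < diagLo n u + numLong n u) =
      Finset.Icc (diagLo n u) (diagLo n u + numLong n u - 1) := by
    ext x
    simp only [Finset.mem_filter, Finset.mem_Icc]
    unfold diagLo diagHi numLong diagLen
    omega
  have h2 : (Finset.Icc (diagLo n u) (diagHi n u)).filter
      (fun x => ¬ x < diagLo n u + numLong n u ∧ diagHi n u - numLong n (u - 1) + 1 < x) =
      Finset.Icc (diagHi n u - numLong n (u - 1) + 2) (diagHi n u) := by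
    ext x
    simp only [Finset.mem_filter, Finset.mem_Icc]
    unfold diagLo diagHi numLong diagLen
    omega
  rw [h1, h2, Int.card_Icc, Int.card_Icc]
  congr 2
  · unfold diagLo numLong diagLen
    omega
  · unfold diagHi numLong diagLen
    omega

/-- The total excess of the long edges between two antidiagonals of lengths `k - 1` and `k`. -/
def stripExcess (k : ℤ) : ℤ :=
  (4 * ((k + 2) / 3) - 2) * (k - (k + 2) / 3) ^ 2 - 2 * k + 1

lemma stripExcess_diagLen {n u : ℤ} (hn : 6 ≤ n) :
    numLong n u * (shift n u ^ 2 + (1 - shift n u) ^ 2 - 2) +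
      (numLong n u - 1) * ((shift n u + 1) ^ 2 + shift n u ^ 2 - 2) =
    stripExcess (diagLen n u) + if u = 2 * n - 3 then -4 else 0 := by
  by_cases h3 : u = 3
  · subst h3
    have h : diagLen n 3 = 2 := by unfold diagLen; omega
    rw [if_neg (by omega)]
    simp [shift, numLong, h, stripExcess]
  by_cases h4 : u = 2 * n - 3
  · subst h4
    have h : diagLen n (2 * n - 3) = 3 := by unfold diagLen; omega
    simp [shift, numLong, h, stripExcess, h3]
  · unfold shift stripExcess
    rw [if_neg h3, if_neg h4, if_neg h4]
    change _ = (4 * numLong n u - 2) * (diagLen n u - numLong n u) ^ 2 - 2 * diagLen n u + 1 + 0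
    ring

lemma sum_box_excess {n : ℕ} (hn : 6 ≤ n) :
    ∑ x ∈ Finset.Icc 1 ((n : ℤ) - 1), ∑ y ∈ Finset.Icc 2 (n : ℤ), excess n (x + y) x =
      2 * (∑ i ∈ Finset.range (n - 1), stripExcess (i + 1)) - 3 := by
  have hn' : (6 : ℤ) ≤ n := by exact_mod_cast hn
  set H : ℤ → ℤ := fun u =>
    (numLong n u - 1) * ((shift n u + 1) ^ 2 + shift n u ^ 2 - 2) with hH
  have hH2 : H 2 = 0 := by
    have : numLong n 2 = 1 := by unfold numLong diagLen; omega
    simp [hH, this]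
  have hH3 : H (2 * n - 1) = 0 := by
    have : numLong n (2 * n - 1) = 1 := by unfold numLong diagLen; omega
    simp [hH, this]
  have hIcc : ∀ g : ℤ → ℤ, ∑ u ∈ Finset.Icc 3 (2 * (n : ℤ) - 1), g u =
      ∑ i ∈ Finset.range (2 * n - 3), g (3 + i) := by
    intro g
    rw [← sum_Icc_eq_sum_range]
    congr 2
    omega
  have htel : ∑ u ∈ Finset.Icc 3 (2 * (n : ℤ) - 1), (H (u - 1) - H u) = 0 := by
    rw [hIcc]
    have := Finset.sum_range_sub' (fun i : ℕ => H (2 + i)) (2 * n - 3)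
    have e : (2 : ℤ) + ((2 * n - 3 : ℕ) : ℤ) = 2 * n - 1 := by omega
    simp only [e, Nat.cast_zero, add_zero, hH2, hH3, sub_zero] at this
    rw [← this]
    refine Finset.sum_congr rfl fun i _ => ?_
    congr 2 <;> push_cast <;> ring
  have hsum : ∑ u ∈ Finset.Icc 3 (2 * (n : ℤ) - 1),
      ∑ x ∈ Finset.Icc (diagLo n u) (diagHi n u), excess n u x =
      ∑ u ∈ Finset.Icc 3 (2 * (n : ℤ) - 1),
        (stripExcess (diagLen n u) + if u = 2 * n - 3 then -4 else 0) := by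
    have h : ∑ u ∈ Finset.Icc 3 (2 * (n : ℤ) - 1),
        ∑ x ∈ Finset.Icc (diagLo n u) (diagHi n u), excess n u x =
        ∑ u ∈ Finset.Icc 3 (2 * (n : ℤ) - 1),
          (stripExcess (diagLen n u) + if u = 2 * n - 3 then -4 else 0) +
        ∑ u ∈ Finset.Icc 3 (2 * (n : ℤ) - 1), (H (u - 1) - H u) := by
      rw [← Finset.sum_add_distrib]
      refine Finset.sum_congr rfl fun u hu => ?_
      rw [Finset.mem_Icc] at hu
      rw [sum_excess hu.1 hu.2, ← stripExcess_diagLen hn']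
      simp only [hH]
      ring
    rw [h, htel, add_zero]
  rw [sum_box n (excess n), hsum, Finset.sum_add_distrib, Finset.sum_ite_eq',
    if_pos (by rw [Finset.mem_Icc]; omega), hIcc]
  obtain ⟨m, rfl⟩ : ∃ m, n = m + 2 := ⟨n - 2, by omega⟩
  have e : 2 * (m + 2) - 3 = m + (m + 1) := by omega
  rw [e, Finset.sum_range_add, show m + 2 - 1 = m + 1 from rfl]
  have h1 : ∑ i ∈ Finset.range m, stripExcess (diagLen ((m + 2 : ℕ) : ℤ) (3 + i)) =
      ∑ i ∈ Finset.range (m + 1), stripExcess (i + 1) + 1 := by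
    rw [Finset.sum_range_succ', add_assoc]
    have : stripExcess ((0 : ℕ) + 1) + 1 = 0 := by simp [stripExcess]
    rw [this, add_zero]
    refine Finset.sum_congr rfl fun i hi => ?_
    rw [Finset.mem_range] at hi
    congr 1
    unfold diagLen
    omega
  have h2 : ∑ i ∈ Finset.range (m + 1),
      stripExcess (diagLen ((m + 2 : ℕ) : ℤ) (3 + ((m + i : ℕ) : ℤ))) =
      ∑ i ∈ Finset.range (m + 1), stripExcess (i + 1) := by
    rw [← Finset.sum_range_reflect]
    refine Finset.sum_congr rfl fun i hi => ?_
    rw [Finset.mem_range] at hi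
    congr 1
    unfold diagLen
    omega
  rw [h1, h2]
  ring

lemma sum_edgeWeight {n : ℕ} (hn : 6 ≤ n) :
    ∑ p ∈ gridFinset n, edgeWeight n p =
      2 * (∑ i ∈ Finset.range (n - 1), stripExcess (i + 1)) + 2 * ((n : ℤ) - 1) ^ 2 +
        2 * ((n : ℤ) - 2) ^ 2 + 2 * ((n : ℤ) - 3) ^ 2 + 2 * n - 6 := by
  have hn' : (6 : ℤ) ≤ n := by exact_mod_cast hn
  have hx : Finset.Icc 1 (n : ℤ) = insert (n : ℤ) (Finset.Icc 1 ((n : ℤ) - 1)) := by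
    ext x
    simp only [Finset.mem_insert, Finset.mem_Icc]
    omega
  have hy : Finset.Icc 1 (n : ℤ) = insert 1 (Finset.Icc 2 (n : ℤ)) := by
    ext x
    simp only [Finset.mem_insert, Finset.mem_Icc]
    omega
  have hright : ∑ y ∈ Finset.Icc 1 (n : ℤ), edgeWeight n (n, y) =
      n + ((n : ℤ) - 2) ^ 2 + ((n : ℤ) - 3) ^ 2 := by
    rw [Finset.sum_congr rfl fun y _ => edgeWeight_right (y := y) hn', Finset.sum_add_distrib,
      Finset.sum_add_distrib, Finset.sum_ite_eq', Finset.sum_ite_eq',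
      if_pos (by rw [Finset.mem_Icc]; omega), if_pos (by rw [Finset.mem_Icc]; omega)]
    simp
  have hcol : ∀ x ∈ Finset.Icc 1 ((n : ℤ) - 1), ∑ y ∈ Finset.Icc 1 (n : ℤ), edgeWeight n (x, y) =
      1 + (∑ y ∈ Finset.Icc 2 (n : ℤ), excess n (x + y) x + 2 * ((n : ℤ) - 1) +
        (if x = 2 then ((n : ℤ) - 3) ^ 2 - 1 else 0) +
        (if x = n - 1 then ((n : ℤ) - 2) ^ 2 - 1 else 0)) := by
    intro x hx
    rw [Finset.mem_Icc] at hx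
    rw [hy, Finset.sum_insert (by simp), edgeWeight_bottom hx.2]
    congr 1
    rw [Finset.sum_congr rfl fun y h => edgeWeight_box (y := y) hn' hx.1 hx.2
      (Finset.mem_Icc.mp h).1]
    simp only [Finset.sum_add_distrib, Prod.mk.injEq, ite_and]
    congr 1
    · congr 1
      · congr 1
        rw [Finset.sum_const, Int.card_Icc, nsmul_eq_mul, mul_comm]
        congr 1
        omega
      · split_ifs
        · rw [Finset.sum_ite_eq', if_pos (by rw [Finset.mem_Icc]; omega)]
        · simp
    · split_ifs
      · rw [Finset.sum_ite_eq', if_pos (by rw [Finset.mem_Icc]; omega)]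
      · simp
  unfold gridFinset
  rw [Finset.sum_product, hx, Finset.sum_insert (by simp), ← hx, hright,
    Finset.sum_congr rfl hcol]
  simp only [Finset.sum_add_distrib]
  rw [sum_box_excess hn, Finset.sum_ite_eq', Finset.sum_ite_eq',
    if_pos (by rw [Finset.mem_Icc]; omega), if_pos (by rw [Finset.mem_Icc]; omega),
    Finset.sum_const, Finset.sum_const, Int.card_Icc, nsmul_eq_mul, nsmul_eq_mul]
  have : (((n : ℤ) - 1 + 1 - 1).toNat : ℤ) = n - 1 := by omega
  rw [this]
  ring

lemma stripExcess_one (t : ℕ) :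
    stripExcess ((3 * t : ℕ) + 1) = 16 * t ^ 3 + 8 * t ^ 2 - 6 * t - 1 := by
  unfold stripExcess
  have : (((3 * t : ℕ) : ℤ) + 1 + 2) / 3 = t + 1 := by omega
  rw [this]
  push_cast
  ring

lemma stripExcess_two (t : ℕ) :
    stripExcess ((3 * t + 1 : ℕ) + 1) = 16 * t ^ 3 + 24 * t ^ 2 + 6 * t - 1 := by
  unfold stripExcess
  have : (((3 * t + 1 : ℕ) : ℤ) + 1 + 2) / 3 = t + 1 := by omega
  rw [this]
  push_cast
  ring

lemma stripExcess_three (t : ℕ) :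
    stripExcess ((3 * t + 2 : ℕ) + 1) =
      16 * ((t : ℤ) + 1) ^ 3 - 8 * ((t : ℤ) + 1) ^ 2 - 6 * ((t : ℤ) + 1) + 1 := by
  unfold stripExcess
  have : (((3 * t + 2 : ℕ) : ℤ) + 1 + 2) / 3 = t + 1 := by omega
  rw [this]
  push_cast
  ring

lemma sum_stripExcess (t : ℕ) :
    ∑ i ∈ Finset.range (3 * t), stripExcess (i + 1) = 12 * (t : ℤ) ^ 4 - 11 * (t : ℤ) ^ 2 := by
  induction t with
  | zero => simp
  | succ t ih =>
    rw [show 3 * (t + 1) = 3 * t + 1 + 1 + 1 by ring, Finset.sum_range_succ,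
      Finset.sum_range_succ, Finset.sum_range_succ, ih, stripExcess_one, stripExcess_two,
      stripExcess_three]
    push_cast
    ring

lemma betaSeq_eq_sum_edgeWeight {n : ℕ} (hn : 6 ≤ n) :
    betaSeq n = ((∑ p ∈ gridFinset n, edgeWeight n p : ℤ) : ℚ) := by
  rw [sum_edgeWeight hn]
  unfold betaSeq dCorr
  obtain ⟨t, rfl | rfl | rfl⟩ : ∃ t, n = 3 * t + 1 ∨ n = 3 * t + 2 ∨ n = 3 * t + 3 :=
    ⟨(n - 1) / 3, by omega⟩
  · rw [if_neg (by omega), if_pos (by omega), show 3 * t + 1 - 1 = 3 * t from rfl,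
      sum_stripExcess]
    push_cast
    ring
  · rw [if_neg (by omega), if_neg (by omega), show 3 * t + 2 - 1 = 3 * t + 1 from rfl,
      Finset.sum_range_succ, sum_stripExcess, stripExcess_one]
    push_cast
    ring
  · rw [if_pos (by omega), show 3 * t + 3 - 1 = 3 * t + 1 + 1 from rfl, Finset.sum_range_succ,
      Finset.sum_range_succ, sum_stripExcess, stripExcess_one, stripExcess_two]
    push_cast
    ring

end GridSnake

/-- For every integer `n ≥ 6`, `a(n) ≥ β(n)`. -/
theorem polyA_ge_beta (n : ℕ) (hn : 6 ≤ n) : betaSeq n ≤ (polyA n : ℚ) := by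
  have hlast : ∃ p ∈ GridSnake.gridFinset n, GridSnake.nextPt n p = (1, 2) :=
    ⟨(1, 1), by rw [GridSnake.mem_gridFinset]; simp only; omega, rfl⟩
  have h := GridSnake.le_polyA_of_orbit (by omega) (GridSnake.nextPt n) (1, 2)
    (by rw [GridSnake.mem_gridFinset]; simp only; omega)
    (fun _ => GridSnake.nextPt_mem_gridFinset hn) (fun _ => GridSnake.reach_of_mem hn) hlast
    (fun _ hp _ => GridSnake.nonCrossing_nextPt hn hp)
  rw [GridSnake.betaSeq_eq_sum_edgeWeight hn]
  simp_rw [← GridSnake.cast_sqLen_nextPt]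
  exact_mod_cast h
end

section
/- The limit superior, as n → ∞, of a(n)/n⁴ is at most 2/3. -/
/-- The integer power sum `∑ (k - c)²` over `1 ≤ k ≤ n`. -/
theorem sum_Icc_sub_sq (n : ℕ) (c : ℝ) :
    ∑ k ∈ Finset.Icc (1 : ℤ) n, ((k : ℝ) - c) ^ 2 =
      (n : ℝ) * (n + 1) * (2 * n + 1) / 6 - c * n * (n + 1) + n * c ^ 2 := by
  induction n with
  | zero => simp
  | succ m ih =>
    have h : Finset.Icc (1 : ℤ) ((m + 1 : ℕ) : ℤ) =
        insert ((m : ℤ) + 1) (Finset.Icc (1 : ℤ) m) := by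
      ext k
      simp only [Finset.mem_Icc, Finset.mem_insert]
      omega
    rw [h, Finset.sum_insert (by simp), ih]
    push_cast
    ring

/-- The squared distances of the points of `A_n` to its centre sum to `n² (n² - 1) / 6`. -/
theorem sum_grid_sub_center_sq (n : ℕ) :
    ∑ p ∈ Finset.Icc (1 : ℤ) n ×ˢ Finset.Icc (1 : ℤ) n,
      (((p.1 : ℝ) - (n + 1) / 2) ^ 2 + ((p.2 : ℝ) - (n + 1) / 2) ^ 2) =
      (n : ℝ) ^ 2 * (n ^ 2 - 1) / 6 := by
  rw [Finset.sum_product]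
  simp only [Finset.sum_add_distrib, Finset.sum_const, Int.card_Icc, sum_Icc_sub_sq,
    nsmul_eq_mul, ← Finset.mul_sum]
  simp only [add_sub_cancel_right, Int.toNat_natCast]
  ring

theorem sum_range_natCast_zmod {M : Type*} [AddCommMonoid M] (m : ℕ) [NeZero m]
    (F : ZMod m → M) : ∑ i ∈ Finset.range m, F (i : ZMod m) = ∑ i, F i := by
  refine Finset.sum_bij' (fun i _ => (i : ZMod m)) (fun a _ => a.val) ?_ ?_ ?_ ?_ ?_
  · simp
  · intro a _
    exact Finset.mem_range.2 (ZMod.val_lt a)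
  · intro a ha
    exact ZMod.val_cast_of_lt (Finset.mem_range.1 ha)
  · intro a _
    exact ZMod.natCast_zmod_val a
  · simp

/-- The parallelogram inequality for the squared length of a grid segment. -/
theorem sqLen_le (p q : ℤ × ℤ) (c : ℝ) :
    (sqLen p q : ℝ) ≤ 2 * (((p.1 : ℝ) - c) ^ 2 + ((p.2 : ℝ) - c) ^ 2) +
      2 * (((q.1 : ℝ) - c) ^ 2 + ((q.2 : ℝ) - c) ^ 2) := by
  have h : (sqLen p q : ℝ) = ((q.1 : ℝ) - p.1) ^ 2 + ((q.2 : ℝ) - p.2) ^ 2 := by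
    simp [sqLen, Nat.cast_natAbs, sq_abs]
  rw [h]
  nlinarith [sq_nonneg ((p.1 : ℝ) - c + (q.1 - c)), sq_nonneg ((p.2 : ℝ) - c + (q.2 - c))]

theorem polyWeight_le {n : ℕ} (hn : 0 < n) {f : ZMod (n ^ 2) → ℤ × ℤ}
    (hf : IsSimpleClosedGridPolygon n f) :
    (polyWeight n f : ℝ) ≤ 2 / 3 * ((n : ℝ) ^ 2 * (n ^ 2 - 1)) := by
  have : NeZero (n ^ 2) := ⟨(pow_pos hn 2).ne'⟩
  set g : ℤ × ℤ → ℝ := fun p =>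
    ((p.1 : ℝ) - (n + 1) / 2) ^ 2 + ((p.2 : ℝ) - (n + 1) / 2) ^ 2
  have himage : Finset.univ.image f = Finset.Icc (1 : ℤ) n ×ˢ Finset.Icc (1 : ℤ) n := by
    ext p
    have hp : p ∈ Set.range f ↔ p ∈ gridSet n := by rw [hf.range_eq]
    simp only [Set.mem_range, gridSet, Set.mem_ofPred_eq] at hp
    simp [hp, and_assoc]
  have hsum : ∑ i, g (f i) = (n : ℝ) ^ 2 * (n ^ 2 - 1) / 6 := by
    rw [← sum_grid_sub_center_sq, ← himage, Finset.sum_image hf.inj.injOn]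
  have hshift : ∑ i, g (f (i + 1)) = ∑ i, g (f i) :=
    Equiv.sum_comp (Equiv.addRight (1 : ZMod (n ^ 2))) fun i => g (f i)
  calc (polyWeight n f : ℝ)
      = ∑ i : ZMod (n ^ 2), (sqLen (f i) (f (i + 1)) : ℝ) := by
        rw [polyWeight, Nat.cast_sum]
        exact sum_range_natCast_zmod (n ^ 2) fun i => (sqLen (f i) (f (i + 1)) : ℝ)
    _ ≤ ∑ i : ZMod (n ^ 2), (2 * g (f i) + 2 * g (f (i + 1))) :=
        Finset.sum_le_sum fun i _ => sqLen_le _ _ _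
    _ = 2 / 3 * ((n : ℝ) ^ 2 * (n ^ 2 - 1)) := by
        rw [Finset.sum_add_distrib, ← Finset.mul_sum, ← Finset.mul_sum, hshift, hsum]
        ring

theorem polyA_le {n : ℕ} (hn : 0 < n) : (polyA n : ℝ) ≤ 2 / 3 * (n : ℝ) ^ 4 := by
  have h : polyA n ≤ ⌊2 / 3 * (n : ℝ) ^ 4⌋₊ := by
    refine csSup_le' ?_
    rintro _ ⟨f, hf, rfl⟩
    refine Nat.le_floor ((polyWeight_le hn hf).trans ?_)
    nlinarith [sq_nonneg (n : ℝ)]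
  exact (Nat.cast_le.2 h).trans (Nat.floor_le (by positivity))

/-- `limsup_{n → ∞} a(n)/n⁴ ≤ 2/3`. -/
theorem limsup_polyA_le :
    Filter.limsup (fun n : ℕ => (polyA n : ℝ) / (n : ℝ) ^ 4) Filter.atTop ≤ (2 / 3 : ℝ) := by
  refine Filter.limsup_le_of_le ?_ ?_
  · exact Filter.IsBoundedUnder.isCoboundedUnder_le
      (Filter.isBoundedUnder_of ⟨0, fun n => by positivity⟩)
  · filter_upwards [Filter.eventually_gt_atTop 0] with n hn
    have : (0 : ℝ) < n := Nat.cast_pos.2 hn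
    rw [div_le_iff₀ (by positivity)]
    exact polyA_le hn
end
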